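/- Let n ≥ 2, let σ be a congruence on P_n^Φ, let 2 ≤ q ≤ n and i ∈ ℕ. Then the relation σ_{qi} := {(α,β) ∈ D_q × D_q : ((i,α),(i,β)) ∈ σ} is either the full relation D_q × D_q or equal to ν_N for some normal subgroup N of S_q (where ν for the trivial subgroup is the equality relation on D_q). Furthermore, if σ_{qi} = D_q × D_q and q ≠ n, then D_{qi} := {i} × D_q is contained in I(σ), the union of all ideals I of P_n^Φ with R_I ⊆ σ. -/

import Mathlib

namespace TPM

/-- Vertex set `{1,…,n} ∪ {1',…,n'}`: `Sum.inl` = unprimed (upper row),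
`Sum.inr` = primed (lower row). -/
abbrev V (n : ℕ) := Fin n ⊕ Fin n

/-- The partition monoid `P_n`: set partitions of the `2n`-element set `V n`,
encoded as equivalence relations (setoids). -/
abbrev PM (n : ℕ) := Setoid (V n)

/-- Three-row vertex set of the product graph: top / middle / bottom. -/
abbrev W (n : ℕ) := Fin n ⊕ (Fin n ⊕ Fin n)

variable {n : ℕ}

/-- First factor: unprimed ↦ top, primed ↦ middle. -/
def topMid : V n → W n
  | Sum.inl i => Sum.inl i
  | Sum.inr i => Sum.inr (Sum.inl i)

/-- Second factor: unprimed ↦ middle, primed ↦ bottom. -/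
def midBot : V n → W n
  | Sum.inl i => Sum.inr (Sum.inl i)
  | Sum.inr i => Sum.inr (Sum.inr i)

/-- Embedding of `V n` as top and bottom rows of the three-row set. -/
def topBot : V n → W n
  | Sum.inl i => Sum.inl i
  | Sum.inr i => Sum.inr (Sum.inr i)

/-- Edge relation of the product graph `Γ(α,β)`. -/
def graphRel (α β : PM n) (x y : W n) : Prop :=
  (∃ u v : V n, α.r u v ∧ x = topMid u ∧ y = topMid v) ∨
  (∃ u v : V n, β.r u v ∧ x = midBot u ∧ y = midBot v)

/-- Connectivity (equivalence closure of the edge relation) in `Γ(α,β)`. -/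
def conn (α β : PM n) : W n → W n → Prop := Relation.EqvGen (graphRel α β)

/-- Connectivity in `Γ(α,β)`, as a setoid on the three-row vertex set. -/
def connSetoid (α β : PM n) : Setoid (W n) :=
  ⟨conn α β, Relation.EqvGen.is_equivalence _⟩

/-- The product of two partitions: `x,y` lie in the same block of `αβ` iff they are
connected in `Γ(α,β)`. -/
def pmul (α β : PM n) : PM n :=
  ⟨fun x y => conn α β (topBot x) (topBot y),
    ⟨fun _ => Relation.EqvGen.refl _, fun h => Relation.EqvGen.symm _ _ h, fun h h' => Relation.EqvGen.trans _ _ _ h h'⟩⟩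

/-- A vertex of the three-row set lies in the middle row. -/
def isMid (x : W n) : Prop := ∃ i : Fin n, x = Sum.inr (Sum.inl i)

/-- `Φ(α,β)`: the number of floating components of `Γ(α,β)`, i.e. connected components
all of whose vertices lie in the middle row. -/
noncomputable def Phi (α β : PM n) : ℕ :=
  Nat.card {c : Quotient (connSetoid α β) //
    ∀ x : W n, Quotient.mk (connSetoid α β) x = c → isMid x}

/-- The rank of a partition: the number of transversal blocks (blocks containing both an
unprimed and a primed element). -/
noncomputable def rnk (α : PM n) : ℕ :=
  Nat.card {c : Quotient α //
    (∃ i : Fin n, Quotient.mk α (Sum.inl i) = c) ∧ ∃ i : Fin n, Quotient.mk α (Sum.inr i) = c}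

/-- Which row of `V n` a point lies in. -/
def side : V n → Bool
  | Sum.inl _ => true
  | Sum.inr _ => false

/-- `α̂`: split each transversal of `α` into its unprimed part and its primed part. -/
def hat (α : PM n) : PM n :=
  ⟨fun x y => α.r x y ∧ side x = side y,
    ⟨fun x => ⟨α.iseqv.refl x, rfl⟩,
     fun h => ⟨α.iseqv.symm h.1, h.2.symm⟩,
     fun h h' => ⟨α.iseqv.trans h.1 h'.1, h.2.trans h'.2⟩⟩⟩

/-- The twisted product on `ℕ × P_n`:  `(i,α)(j,β) = (i + j + Φ(α,β), αβ)`. -/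
noncomputable def tmul (a b : ℕ × PM n) : ℕ × PM n :=
  (a.1 + b.1 + Phi a.2 b.2, pmul a.2 b.2)

/-- A congruence on a set equipped with a binary operation: an equivalence relation
compatible with the operation on both sides. -/
def IsCongruence {M : Type*} (mul : M → M → M) (σ : M → M → Prop) : Prop :=
  Equivalence σ ∧ ∀ x y a, σ x y → σ (mul a x) (mul a y) ∧ σ (mul x a) (mul y a)

/-- Green's relation `R`: equality of the right ideals `xM = yM`. -/
def greenR {M : Type*} (mul : M → M → M) (x y : M) : Prop :=
  Set.range (mul x) = Set.range (mul y)

/-- Green's relation `L`: `Mx = My`. -/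
def greenL {M : Type*} (mul : M → M → M) (x y : M) : Prop :=
  Set.range (fun a => mul a x) = Set.range (fun a => mul a y)

/-- The principal two-sided ideal `MxM`. -/
def jSet {M : Type*} (mul : M → M → M) (x : M) : Set M :=
  Set.range (fun p : M × M => mul (mul p.1 x) p.2)

/-- Green's relation `J`: `MxM = MyM`. -/
def greenJ {M : Type*} (mul : M → M → M) (x y : M) : Prop :=
  jSet mul x = jSet mul y

/-- Green's relation `H = R ∩ L`. -/
def greenH {M : Type*} (mul : M → M → M) (x y : M) : Prop :=
  greenR mul x y ∧ greenL mul x y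

/-- Green's relation `D = R ∘ L`. -/
def greenD {M : Type*} (mul : M → M → M) (x y : M) : Prop :=
  ∃ z, greenR mul x z ∧ greenL mul z y

/-- `pd(α,β)` satisfies `P`, where `α` has `p` transversals: there are representatives
`a s` of the upper parts of the `p` (pairwise distinct) transversals of `α`, with `b s`
representing the corresponding lower parts, and a permutation `π` with `P π` such that the
block of `β` containing `a s` contains `b (π s)`.  (For H-related `α, β ∈ D_p` this says
exactly that some representation of the permutational difference `pd(α,β)` satisfies `P`.) -/
def pdIn (p : ℕ) (P : Equiv.Perm (Fin p) → Prop) (α β : PM n) : Prop :=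
  ∃ (a b : Fin p → Fin n) (π : Equiv.Perm (Fin p)),
    (∀ s t, α.r (Sum.inl (a s)) (Sum.inl (a t)) → s = t) ∧
    (∀ s, α.r (Sum.inl (a s)) (Sum.inr (b s))) ∧
    (∀ s, β.r (Sum.inl (a s)) (Sum.inr (b (π s)))) ∧
    P π

/-- The relation `ν_N` on `D_p`, for a subgroup `N ≤ S_p`:  H-related pairs of rank-`p`
partitions whose permutational difference lies in `N`. -/
def nuRel (p : ℕ) (N : Subgroup (Equiv.Perm (Fin p))) (α β : PM n) : Prop :=
  rnk α = p ∧ rnk β = p ∧ greenH pmul α β ∧ pdIn p (· ∈ N) α β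

/-- The congruence `(m, m+d)^♯` on the additive monoid `ℕ` (intended for `d ≥ 1`). -/
def natCong (m d : ℕ) (i j : ℕ) : Prop :=
  i = j ∨ (m ≤ i ∧ m ≤ j ∧ i % d = j % d)

/-- `min θ ≤ i` for a congruence `θ` on `ℕ` (with `min Δ_ℕ = ∞`). -/
def minLE (θ : ℕ → ℕ → Prop) (i : ℕ) : Prop :=
  ∃ a b, θ a b ∧ a ≠ b ∧ a ≤ i

/-- `k ≤ min θ` for a congruence `θ` on `ℕ` (with `min Δ_ℕ = ∞`). -/
def leMin (k : ℕ) (θ : ℕ → ℕ → Prop) : Prop :=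
  ∀ a b, θ a b → a ≠ b → k ≤ a

/-- The possible entries of a C-matrix. -/
inductive CEntry : Type
  | delta | muUp | muDown | mu | lam | rho | R
  | nsym (q : ℕ) (N : Subgroup (Equiv.Perm (Fin q)))

/-- Whether a C-matrix entry is an N-symbol. -/
def isNsym : CEntry → Prop
  | CEntry.nsym _ _ => True
  | _ => False

/-- The allowed values of the symbol `ζ` in row types RT2, RT5, RT6. -/
def isZeta (e : CEntry) : Prop :=
  e = CEntry.mu ∨ e = CEntry.muUp ∨ e = CEntry.muDown ∨ e = CEntry.delta

/-- The allowed values of the symbol `ξ` in row types RT4–RT7: any of `μ,ρ,λ,R` if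
`d = 1`, and only `μ` if `d > 1`. -/
def xiOK (d : ℕ) (e : CEntry) : Prop :=
  e = CEntry.mu ∨ (d = 1 ∧ (e = CEntry.rho ∨ e = CEntry.lam ∨ e = CEntry.R))

/-- Row type RT1 for rows 0 and 1: all entries `Δ`. -/
def RT1 (M0 M1 : ℕ → CEntry) : Prop :=
  (∀ i, M0 i = CEntry.delta) ∧ (∀ i, M1 i = CEntry.delta)

/-- Row type RT2. -/
def RT2 (Θ0 Θ1 : ℕ → ℕ → Prop) (M0 M1 : ℕ → CEntry) : Prop :=
  Θ0 = Eq ∧ Θ1 = Eq ∧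
  ∃ i ζ, isZeta ζ ∧
    (∀ j, j < i → M0 j = CEntry.delta) ∧ (∀ j, i ≤ j → M0 j = CEntry.mu) ∧
    (∀ j, j < i → M1 j = CEntry.delta) ∧ M1 i = ζ ∧ (∀ j, i < j → M1 j = CEntry.mu)

/-- Row type RT3. -/
def RT3 (Θ0 : ℕ → ℕ → Prop) (M0 M1 : ℕ → CEntry) : Prop :=
  ∃ m ξ, Θ0 = natCong m 1 ∧ (ξ = CEntry.rho ∨ ξ = CEntry.lam ∨ ξ = CEntry.R) ∧
    (∀ i, M1 i = CEntry.delta) ∧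
    (∀ j, j < m → M0 j = CEntry.delta) ∧ (∀ j, m ≤ j → M0 j = ξ)

/-- Row type RT4. -/
def RT4 (Θ0 Θ1 : ℕ → ℕ → Prop) (M0 M1 : ℕ → CEntry) : Prop :=
  ∃ m d ξ, 1 ≤ d ∧ Θ0 = natCong m d ∧ Θ1 = natCong m d ∧ xiOK d ξ ∧
    (∀ j, j < m → M0 j = CEntry.delta ∧ M1 j = CEntry.delta) ∧
    (∀ j, m ≤ j → M0 j = ξ ∧ M1 j = ξ)

/-- Row type RT5. -/
def RT5 (Θ0 Θ1 : ℕ → ℕ → Prop) (M0 M1 : ℕ → CEntry) : Prop :=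
  ∃ m d i ξ ζ, 1 ≤ d ∧ i < m ∧ Θ0 = natCong m d ∧ Θ1 = natCong (m + 1) d ∧
    xiOK d ξ ∧ isZeta ζ ∧
    (∀ j, j < i → M0 j = CEntry.delta) ∧ (∀ j, i ≤ j → j < m → M0 j = CEntry.mu) ∧
    (∀ j, m ≤ j → M0 j = ξ) ∧
    (∀ j, j < i → M1 j = CEntry.delta) ∧ M1 i = ζ ∧
    (∀ j, i < j → j ≤ m → M1 j = CEntry.mu) ∧ (∀ j, m < j → M1 j = ξ)

/-- Row type RT6. -/
def RT6 (Θ0 Θ1 : ℕ → ℕ → Prop) (M0 M1 : ℕ → CEntry) : Prop :=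
  ∃ m l d ξ ζ, 1 ≤ d ∧ m < l ∧ Θ0 = natCong m d ∧ Θ1 = natCong l d ∧
    xiOK d ξ ∧ isZeta ζ ∧
    (∀ j, j < m → M0 j = CEntry.delta) ∧ (∀ j, m ≤ j → M0 j = ξ) ∧
    (∀ j, j < l - 1 → M1 j = CEntry.delta) ∧ M1 (l - 1) = ζ ∧ (∀ j, l ≤ j → M1 j = ξ)

/-- Row type RT7. -/
def RT7 (Θ0 Θ1 : ℕ → ℕ → Prop) (M0 M1 : ℕ → CEntry) : Prop :=
  ∃ m l d ξ, 1 ≤ d ∧ 0 < m ∧ m + 1 < l ∧ (l - 1) % d = m % d ∧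
    Θ0 = natCong m d ∧ Θ1 = natCong l d ∧ xiOK d ξ ∧
    (∀ j, j < m - 1 → M0 j = CEntry.delta) ∧ M0 (m - 1) = CEntry.mu ∧
    (∀ j, m ≤ j → M0 j = ξ) ∧
    (∀ j, j < l - 1 → M1 j = CEntry.delta) ∧ M1 (l - 1) = CEntry.mu ∧
    (∀ j, l ≤ j → M1 j = ξ)

/-- Row type RT8 for a row `q ≥ 2`: all entries `Δ`. -/
def RT8 (Mq : ℕ → CEntry) : Prop := ∀ i, Mq i = CEntry.delta

/-- Row type RT9 for a row `q ≥ 2`. -/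
def RT9 (q : ℕ) (Θq : ℕ → ℕ → Prop) (Mq : ℕ → CEntry) : Prop :=
  ∃ (i k : ℕ) (Ns : ℕ → Subgroup (Equiv.Perm (Fin q))),
    i ≤ k ∧ leMin k Θq ∧
    (∀ j, i ≤ j → j ≤ k → Ns j ≠ ⊥ ∧ (Ns j).Normal) ∧
    (∀ j j', i ≤ j → j ≤ j' → j' ≤ k → Ns j ≤ Ns j') ∧
    (∀ j, j < i → Mq j = CEntry.delta) ∧
    (∀ j, i ≤ j → j < k → Mq j = CEntry.nsym q (Ns j)) ∧
    (∀ j, k ≤ j → Mq j = CEntry.nsym q (Ns k))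

/-- Row type RT10 for a row `q ≥ 2`. -/
def RT10 (q : ℕ) (Θq : ℕ → ℕ → Prop) (Mq : ℕ → CEntry) : Prop :=
  ∃ (i m : ℕ) (Ns : ℕ → Subgroup (Equiv.Perm (Fin q))),
    i ≤ m ∧ Θq = natCong m 1 ∧
    (∀ j, i ≤ j → j < m → Ns j ≠ ⊥ ∧ (Ns j).Normal) ∧
    (∀ j j', i ≤ j → j ≤ j' → j' < m → Ns j ≤ Ns j') ∧
    (∀ j, j < i → Mq j = CEntry.delta) ∧
    (∀ j, i ≤ j → j < m → Mq j = CEntry.nsym q (Ns j)) ∧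
    (∀ j, m ≤ j → Mq j = CEntry.R)

/-- A C-pair for `P_n^Φ`: a descending chain `Θ = (θ_0 ⊇ ⋯ ⊇ θ_n)` of congruences on
`(ℕ,+)` together with a matrix `M = (M_{qi})`, `0 ≤ q ≤ n`, `i ∈ ℕ`, whose rows 0 and 1
jointly have one of the types RT1–RT7, whose rows `q ≥ 2` have one of the types RT8–RT10,
and which satisfies the verticality conditions (V1) and (V2). -/
def IsCPair (n : ℕ) (Θ : ℕ → ℕ → ℕ → Prop) (M : ℕ → ℕ → CEntry) : Prop :=
  (∀ q, q ≤ n → IsCongruence (· + ·) (Θ q)) ∧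
  (∀ q r, q ≤ r → r ≤ n → ∀ i j, Θ r i j → Θ q i j) ∧
  (RT1 (M 0) (M 1) ∨ RT2 (Θ 0) (Θ 1) (M 0) (M 1) ∨ RT3 (Θ 0) (M 0) (M 1) ∨
    RT4 (Θ 0) (Θ 1) (M 0) (M 1) ∨ RT5 (Θ 0) (Θ 1) (M 0) (M 1) ∨
    RT6 (Θ 0) (Θ 1) (M 0) (M 1) ∨ RT7 (Θ 0) (Θ 1) (M 0) (M 1)) ∧
  (∀ q, 2 ≤ q → q ≤ n → (RT8 (M q) ∨ RT9 q (Θ q) (M q) ∨ RT10 q (Θ q) (M q))) ∧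
  (∀ q i, 1 ≤ q → q ≤ n → isNsym (M q i) →
    ¬(M (q - 1) i = CEntry.delta ∨ M (q - 1) i = CEntry.muUp ∨
      M (q - 1) i = CEntry.muDown ∨ isNsym (M (q - 1) i))) ∧
  (∀ q i, 2 ≤ q → q ≤ n → M q i = CEntry.R → M (q - 1) i = CEntry.R)

/-- The relation `cg(Θ,M)` on `P_n^Φ` associated with a C-pair `(Θ,M)`: conditions
(C1)–(C8). -/
def cg (n : ℕ) (Θ : ℕ → ℕ → ℕ → Prop) (M : ℕ → ℕ → CEntry)
    (a b : ℕ × PM n) : Prop :=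
  -- (C1)
  (M (rnk a.2) a.1 = CEntry.delta ∧ M (rnk b.2) b.1 = CEntry.delta ∧
    Θ (rnk a.2) a.1 b.1 ∧ a.2 = b.2) ∨
  -- (C2)
  (M (rnk a.2) a.1 = CEntry.R ∧ M (rnk b.2) b.1 = CEntry.R) ∨
  -- (C3)
  (∃ p N, M (rnk a.2) a.1 = CEntry.nsym p N ∧ M (rnk b.2) b.1 = CEntry.nsym p N ∧
    Θ (rnk a.2) a.1 b.1 ∧ rnk a.2 = p ∧ greenH pmul a.2 b.2 ∧ pdIn p (· ∈ N) a.2 b.2) ∨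
  -- (C4)
  (M (rnk a.2) a.1 = CEntry.lam ∧ M (rnk b.2) b.1 = CEntry.lam ∧
    greenL pmul (hat a.2) (hat b.2)) ∨
  -- (C5)
  (M (rnk a.2) a.1 = CEntry.rho ∧ M (rnk b.2) b.1 = CEntry.rho ∧
    greenR pmul (hat a.2) (hat b.2)) ∨
  -- (C6)
  (M (rnk a.2) a.1 = CEntry.muDown ∧ M (rnk b.2) b.1 = CEntry.muDown ∧
    hat a.2 = hat b.2 ∧ greenL pmul a.2 b.2) ∨
  -- (C7)
  (M (rnk a.2) a.1 = CEntry.muUp ∧ M (rnk b.2) b.1 = CEntry.muUp ∧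
    hat a.2 = hat b.2 ∧ greenR pmul a.2 b.2) ∨
  -- (C8)
  (M (rnk a.2) a.1 = CEntry.mu ∧ M (rnk b.2) b.1 = CEntry.mu ∧
    hat a.2 = hat b.2 ∧
    ((rnk a.2 = rnk b.2 ∧ Θ (rnk a.2) a.1 b.1) ∨
     (rnk a.2 ≠ rnk b.2 ∧ Θ 0 (a.1 + rnk b.2) (b.1 + rnk a.2) ∧
        ¬ minLE (Θ (rnk a.2)) a.1 ∧ ¬ minLE (Θ (rnk b.2)) b.1) ∨
     (rnk a.2 ≠ rnk b.2 ∧ Θ 0 (a.1 + rnk b.2) (b.1 + rnk a.2) ∧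
        minLE (Θ (rnk a.2)) a.1 ∧ minLE (Θ (rnk b.2)) b.1)))

/-- The C-pair `(Θ,M)` is exceptional with exceptional row `q`, where
`θ_q = (m, m+2d)^♯`. -/
def ExcAt (n : ℕ) (Θ : ℕ → ℕ → ℕ → Prop) (M : ℕ → ℕ → CEntry) (q m d : ℕ) : Prop :=
  2 ≤ q ∧ q ≤ n ∧ 1 ≤ d ∧ Θ q = natCong m (2 * d) ∧
  ((2 < q ∧ M q m = CEntry.nsym q (alternatingGroup (Fin q))) ∨
   (q = 2 ∧ M 2 m = CEntry.delta ∧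
     (M 1 m = CEntry.mu ∨ M 1 m = CEntry.rho ∨ M 1 m = CEntry.lam ∨ M 1 m = CEntry.R) ∧
     (∀ i j, natCong m d i j → Θ 1 i j)))

/-- The exceptional congruence `cgx(Θ,M)` associated with an exceptional C-pair:
`cg(Θ,M)` together with the pairs of (C9). -/
def cgx (n : ℕ) (Θ : ℕ → ℕ → ℕ → Prop) (M : ℕ → ℕ → CEntry) (q m d : ℕ)
    (a b : ℕ × PM n) : Prop :=
  cg n Θ M a b ∨
  (rnk a.2 = q ∧ rnk b.2 = q ∧ natCong m d a.1 b.1 ∧ ¬ Θ q a.1 b.1 ∧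
    greenH pmul a.2 b.2 ∧ pdIn q (fun π => π ∉ alternatingGroup (Fin q)) a.2 b.2)

/-- The Rees relation of a subset `I`. -/
def rees {M : Type*} (I : Set M) (x y : M) : Prop := x = y ∨ (x ∈ I ∧ y ∈ I)

/-- A (possibly empty) ideal of `P_n^Φ`: `MIM ⊆ I`. -/
def tIdeal (n : ℕ) (I : Set (ℕ × PM n)) : Prop :=
  ∀ a b x, x ∈ I → tmul (tmul a x) b ∈ I

/-- `I(σ)`: the union of all ideals `I` of `P_n^Φ` whose Rees congruence is contained
in `σ`. -/
def Isig (n : ℕ) (σ : (ℕ × PM n) → (ℕ × PM n) → Prop) : Set (ℕ × PM n) :=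
  ⋃₀ {I | tIdeal n I ∧ ∀ x y, rees I x y → σ x y}

/-- The 0-twisted partition monoid `P_{n,0}^Φ`, carried by `Option (P_n)` with
`none` the zero element `✗`. -/
noncomputable def mul0 (a b : Option (PM n)) : Option (PM n) :=
  match a, b with
  | some α, some β => if Phi α β = 0 then some (pmul α β) else none
  | _, _ => none

/-- `rank a ≤ q`, where `rank ✗ = -∞`. -/
def rnkLE (a : Option (PM n)) (q : ℕ) : Prop :=
  ∀ α, a = some α → rnk α ≤ q

/-- The Rees congruence `R_q` on `P_{n,0}^Φ`. -/
def ReesQ (q : ℕ) (a b : Option (PM n)) : Prop :=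
  a = b ∨ (rnkLE a q ∧ rnkLE b q)

/-- Lift a relation on `P_n` to `P_{n,0}^Φ = P_n ∪ {✗}`. -/
def lift2 (r : PM n → PM n → Prop) (a b : Option (PM n)) : Prop :=
  ∃ α β, a = some α ∧ b = some β ∧ r α β


/-! ### Basic tools for computing products -/

abbrev wtop (x : Fin n) : W n := Sum.inl x
abbrev wmid (x : Fin n) : W n := Sum.inr (Sum.inl x)
abbrev wbot (x : Fin n) : W n := Sum.inr (Sum.inr x)

lemma conn_le {α β : PM n} {X : Type*} (F : W n → X)
    (h1 : ∀ u v, α.r u v → F (topMid u) = F (topMid v))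
    (h2 : ∀ u v, β.r u v → F (midBot u) = F (midBot v))
    {x y : W n} (h : conn α β x y) : F x = F y := by
  induction h with
  | rel x y h =>
    rcases h with ⟨u, v, h, rfl, rfl⟩ | ⟨u, v, h, rfl, rfl⟩
    · exact h1 _ _ h
    · exact h2 _ _ h
  | refl x => rfl
  | symm x y _ ih => exact ih.symm
  | trans x y z _ _ ih1 ih2 => exact ih1.trans ih2

lemma conn_l {α β : PM n} {u v : V n} (h : α.r u v) : conn α β (topMid u) (topMid v) :=
  Relation.EqvGen.rel _ _ (Or.inl ⟨u, v, h, rfl, rfl⟩)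

lemma conn_r {α β : PM n} {u v : V n} (h : β.r u v) : conn α β (midBot u) (midBot v) :=
  Relation.EqvGen.rel _ _ (Or.inr ⟨u, v, h, rfl, rfl⟩)

lemma conn_symm {α β : PM n} {u v : W n} (h : conn α β u v) : conn α β v u :=
  Relation.EqvGen.symm _ _ h

lemma conn_trans {α β : PM n} {u v w : W n} (h : conn α β u v) (h' : conn α β v w) :
    conn α β u w := Relation.EqvGen.trans _ _ _ h h'

lemma conn_refl {α β : PM n} (u : W n) : conn α β u u := Relation.EqvGen.refl _

lemma not_isMid_topBot (v : V n) : ¬ isMid (topBot v) := by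
  rintro ⟨i, h⟩
  cases v <;> simp [topBot] at h

lemma W_cases (x : W n) : (∃ v : V n, x = topBot v) ∨ isMid x := by
  rcases x with x | x | x
  · exact Or.inl ⟨Sum.inl x, rfl⟩
  · exact Or.inr ⟨x, rfl⟩
  · exact Or.inl ⟨Sum.inr x, rfl⟩

lemma Phi_zero {α β : PM n} (h : ∀ m : Fin n, ∃ v : V n, conn α β (wmid m) (topBot v)) :
    Phi α β = 0 := by
  unfold Phi
  have : IsEmpty {c : Quotient (connSetoid α β) //
    ∀ x : W n, Quotient.mk (connSetoid α β) x = c → isMid x} := by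
    constructor
    rintro ⟨c, hc⟩
    induction c using Quotient.inductionOn with
    | h x =>
      obtain ⟨m, rfl⟩ := hc x rfl
      obtain ⟨v, hv⟩ := h m
      exact not_isMid_topBot v (hc _ (Quotient.sound (conn_symm hv)))
  exact Nat.card_of_isEmpty

lemma Phi_one {α β : PM n} (m : Fin n) (h : ∀ v : V n, ¬ conn α β (wmid m) (topBot v))
    (h' : ∀ m' : Fin n, conn α β (wmid m) (wmid m') ∨ ∃ v : V n, conn α β (wmid m') (topBot v)) :
    Phi α β = 1 := by
  unfold Phi
  rw [Nat.card_eq_one_iff_unique]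
  refine ⟨⟨?_⟩, ⟨⟨Quotient.mk _ (wmid m), ?_⟩⟩⟩
  · have key : ∀ c : {c : Quotient (connSetoid α β) //
        ∀ x : W n, Quotient.mk (connSetoid α β) x = c → isMid x},
        c.1 = Quotient.mk (connSetoid α β) (wmid m) := by
      rintro ⟨c, hc⟩
      induction c using Quotient.inductionOn with
      | h x =>
        obtain ⟨m', rfl⟩ := hc x rfl
        rcases h' m' with h1 | ⟨v, hv⟩
        · exact Quotient.sound (conn_symm h1)
        · exact absurd (hc _ (Quotient.sound (conn_symm hv))) (not_isMid_topBot v)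
    intro a b
    exact Subtype.ext ((key a).trans (key b).symm)
  · intro x hx
    rcases W_cases x with ⟨v, rfl⟩ | hm
    · exact absurd (conn_symm (Quotient.exact hx)) (h v)
    · exact hm

lemma PM_ext {α β : PM n} (h1 : ∀ u v, α.r u v → β.r u v) (h2 : ∀ u v, β.r u v → α.r u v) :
    α = β := Setoid.ext fun u v => ⟨h1 u v, h2 u v⟩

/-! ### The anti-involution -/

def star (α : PM n) : PM n := Setoid.comap Sum.swap α

lemma star_r (α : PM n) (u v : V n) : (star α).r u v ↔ α.r u.swap v.swap := Iff.rfl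

lemma star_star (α : PM n) : star (star α) = α := by
  apply PM_ext <;> intro u v h <;> simpa [star_r] using h

def rev : W n → W n
  | Sum.inl i => Sum.inr (Sum.inr i)
  | Sum.inr (Sum.inl i) => Sum.inr (Sum.inl i)
  | Sum.inr (Sum.inr i) => Sum.inl i

lemma rev_rev (x : W n) : rev (rev x) = x := by rcases x with x | x | x <;> rfl

lemma rev_topMid (u : V n) : rev (topMid u) = midBot u.swap := by cases u <;> rfl
lemma rev_midBot (u : V n) : rev (midBot u) = topMid u.swap := by cases u <;> rfl
lemma rev_topBot (u : V n) : rev (topBot u) = topBot u.swap := by cases u <;> rfl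

lemma conn_star {α β : PM n} {x y : W n} (h : conn (star α) (star β) x y) :
    conn β α (rev x) (rev y) := by
  have := conn_le (α := star α) (β := star β)
    (fun z => Quotient.mk (connSetoid β α) (rev z)) ?_ ?_ h
  · exact Quotient.exact this
  · intro u v huv
    apply Quotient.sound
    rw [rev_topMid, rev_topMid]
    exact conn_r huv
  · intro u v huv
    apply Quotient.sound
    rw [rev_midBot, rev_midBot]
    exact conn_l huv

lemma conn_star' {α β : PM n} {x y : W n} (h : conn α β x y) :
    conn (star β) (star α) (rev x) (rev y) := by
  apply conn_star
  rwa [star_star, star_star]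

lemma pmul_star (α β : PM n) : pmul (star α) (star β) = star (pmul β α) := by
  apply PM_ext
  · intro u v h
    have := conn_star h
    rwa [rev_topBot, rev_topBot] at this
  · intro u v h
    have := conn_star' h
    rwa [rev_topBot, rev_topBot, Sum.swap_swap, Sum.swap_swap] at this

lemma isMid_rev {x : W n} : isMid (rev x) ↔ isMid x := by
  rcases x with x | x | x <;> simp [isMid, rev]

lemma Phi_star (α β : PM n) : Phi (star α) (star β) = Phi β α := by
  unfold Phi
  let E : Quotient (connSetoid (star α) (star β)) ≃ Quotient (connSetoid β α) :=
    { toFun := Quotient.map rev (fun x y h => conn_star h)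
      invFun := Quotient.map rev (fun x y h => conn_star' h)
      left_inv := by
        intro c
        induction c using Quotient.inductionOn with
        | h x => exact congrArg (Quotient.mk _) (rev_rev x)
      right_inv := by
        intro c
        induction c using Quotient.inductionOn with
        | h x => exact congrArg (Quotient.mk _) (rev_rev x) }
  refine Nat.card_congr (E.subtypeEquiv ?_)
  intro c
  induction c using Quotient.inductionOn with
  | h x =>
    constructor
    · intro h y hy
      rw [← isMid_rev]
      apply h
      apply Quotient.sound
      have := conn_star' (Quotient.exact hy)
      rwa [rev_rev] at this
    · intro h y hy
      rw [← isMid_rev]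
      apply h
      apply Quotient.sound
      exact conn_star (Quotient.exact hy)

lemma rnk_star (α : PM n) : rnk (star α) = rnk α := by
  unfold rnk
  let E : Quotient (star α) ≃ Quotient α :=
    { toFun := Quotient.map Sum.swap (fun x y h => h)
      invFun := Quotient.map Sum.swap (fun x y h => by
        show α.r _ _
        rw [Sum.swap_swap, Sum.swap_swap]; exact h)
      left_inv := by
        intro c
        induction c using Quotient.inductionOn with
        | h x => exact congrArg (Quotient.mk _) (Sum.swap_swap x)
      right_inv := by
        intro c
        induction c using Quotient.inductionOn with
        | h x => exact congrArg (Quotient.mk _) (Sum.swap_swap x) }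
  refine Nat.card_congr (E.subtypeEquiv ?_)
  intro c
  have e1 : ∀ i, (Quotient.mk (star α) (Sum.inl i) = c ↔ Quotient.mk α (Sum.inr i) = E c) :=
    fun i => (E.apply_eq_iff_eq (x := Quotient.mk (star α) (Sum.inl i))).symm
  have e2 : ∀ i, (Quotient.mk (star α) (Sum.inr i) = c ↔ Quotient.mk α (Sum.inl i) = E c) :=
    fun i => (E.apply_eq_iff_eq (x := Quotient.mk (star α) (Sum.inr i))).symm
  simp only [e1, e2]
  exact and_comm

/-! ### Left and two-sided multipliers -/

/-- upper kernel `e`, lower vertex `j` attached to the upper vertex `c j`. -/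
def Lm (e : Setoid (Fin n)) (c : Fin n → Fin n) : PM n := Setoid.comap (Sum.elim id c) e

lemma Lm_conn (e : Setoid (Fin n)) (c : Fin n → Fin n) (β : PM n) (j : Fin n) :
    conn (Lm e c) β (wmid j) (wtop (c j)) :=
  conn_l (u := Sum.inr j) (v := Sum.inl (c j)) (e.refl (c j))

lemma Phi_Lm (e : Setoid (Fin n)) (c : Fin n → Fin n) (β : PM n) : Phi (Lm e c) β = 0 :=
  Phi_zero fun m => ⟨Sum.inl (c m), Lm_conn e c β m⟩

lemma Lm_le {e : Setoid (Fin n)} {c : Fin n → Fin n} {β θ : PM n}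
    (h1 : ∀ x y, e.r x y → θ.r (Sum.inl x) (Sum.inl y))
    (h2 : ∀ u v, β.r u v → θ.r (Sum.map c id u) (Sum.map c id v)) :
    ∀ u v, (pmul (Lm e c) β).r u v → θ.r u v := by
  intro u v h
  let F : W n → Quotient θ := Sum.elim (fun x => Quotient.mk θ (Sum.inl x))
    (Sum.elim (fun j => Quotient.mk θ (Sum.inl (c j))) (fun y => Quotient.mk θ (Sum.inr y)))
  have := conn_le (α := Lm e c) (β := β) F ?_ ?_ h
  · rcases u with u | u <;> rcases v with v | v <;> exact Quotient.exact this
  · intro u v huv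
    rcases u with u | u <;> rcases v with v | v <;> exact Quotient.sound (h1 _ _ huv)
  · intro u v huv
    have := h2 u v huv
    rcases u with u | u <;> rcases v with v | v <;> exact Quotient.sound this

lemma Lm_e {e : Setoid (Fin n)} {c : Fin n → Fin n} {β : PM n} {x y : Fin n} (h : e.r x y) :
    (pmul (Lm e c) β).r (Sum.inl x) (Sum.inl y) :=
  conn_l (u := Sum.inl x) (v := Sum.inl y) h

lemma Lm_conn2 {e : Setoid (Fin n)} {c : Fin n → Fin n} {β : PM n} (u : V n) :
    conn (Lm e c) β (topBot (Sum.map c id u)) (midBot u) := by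
  rcases u with u | u
  · exact conn_symm (Lm_conn e c β u)
  · exact conn_refl _

lemma Lm_β {e : Setoid (Fin n)} {c : Fin n → Fin n} {β : PM n} {u v : V n} (h : β.r u v) :
    (pmul (Lm e c) β).r (Sum.map c id u) (Sum.map c id v) :=
  conn_trans (Lm_conn2 u) (conn_trans (conn_r h) (conn_symm (Lm_conn2 v)))

lemma pmul_star_right (β γ : PM n) : pmul β (star γ) = star (pmul γ (star β)) := by
  rw [← pmul_star, star_star]

lemma Phi_star_right (β γ : PM n) : Phi β (star γ) = Phi γ (star β) := by
  rw [← Phi_star, star_star]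

def Tm (e : Setoid (Fin n)) (c : Fin n → Fin n) (e' : Setoid (Fin n)) (c' : Fin n → Fin n)
    (x : PM n) : PM n := pmul (pmul (Lm e c) x) (star (Lm e' c'))

lemma Tm_le {e : Setoid (Fin n)} {c : Fin n → Fin n} {e' : Setoid (Fin n)} {c' : Fin n → Fin n}
    {β θ : PM n}
    (h1 : ∀ x y, e.r x y → θ.r (Sum.inl x) (Sum.inl y))
    (h1' : ∀ x y, e'.r x y → θ.r (Sum.inr x) (Sum.inr y))
    (h2 : ∀ u v, β.r u v → θ.r (Sum.map c c' u) (Sum.map c c' v)) :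
    ∀ u v, (Tm e c e' c' β).r u v → θ.r u v := by
  intro u v h
  unfold Tm at h
  rw [pmul_star_right] at h
  have := Lm_le (e := e') (c := c') (β := star (pmul (Lm e c) β)) (θ := star θ) ?_ ?_ _ _ h
  · simpa [star_r] using this
  · intro x y h; exact h1' x y h
  · intro u v h
    have h3 : ∀ u v, (pmul (Lm e c) β).r u v →
        (Setoid.comap (Sum.map id c') θ).r u v := by
      apply Lm_le
      · intro x y h; exact h1 x y h
      · intro u v h
        have := h2 u v h
        show θ.r _ _
        rcases u with u | u <;> rcases v with v | v <;> exact this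
    have := h3 _ _ h
    show θ.r _ _
    rcases u with u | u <;> rcases v with v | v <;> exact this

lemma Tm_e {e : Setoid (Fin n)} {c : Fin n → Fin n} {e' : Setoid (Fin n)} {c' : Fin n → Fin n}
    {β : PM n} {x y : Fin n} (h : e.r x y) : (Tm e c e' c' β).r (Sum.inl x) (Sum.inl y) := by
  unfold Tm
  rw [pmul_star_right]
  exact Lm_β (u := Sum.inr x) (v := Sum.inr y) (β := star (pmul (Lm e c) β)) (Lm_e h)

lemma Tm_e' {e : Setoid (Fin n)} {c : Fin n → Fin n} {e' : Setoid (Fin n)} {c' : Fin n → Fin n}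
    {β : PM n} {x y : Fin n} (h : e'.r x y) : (Tm e c e' c' β).r (Sum.inr x) (Sum.inr y) := by
  unfold Tm
  rw [pmul_star_right]
  exact Lm_e (β := star (pmul (Lm e c) β)) (c := c') h

lemma Tm_β {e : Setoid (Fin n)} {c : Fin n → Fin n} {e' : Setoid (Fin n)} {c' : Fin n → Fin n}
    {β : PM n} {u v : V n} (h : β.r u v) :
    (Tm e c e' c' β).r (Sum.map c c' u) (Sum.map c c' v) := by
  unfold Tm
  rw [pmul_star_right]
  have h1 : (pmul (Lm e c) β).r _ _ := Lm_β h
  have h2 : (star (pmul (Lm e c) β)).r (Sum.map c id u).swap (Sum.map c id v).swap := by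
    rw [star_r, Sum.swap_swap, Sum.swap_swap]; exact h1
  have h3 := Lm_β (e := e') (c := c') h2
  rw [star_r]
  rcases u with u | u <;> rcases v with v | v <;> exact h3

/-- the full partition with kernel `e`. -/
def fe (e : Setoid (Fin n)) : PM n := Lm e id

lemma fe_mul {e : Setoid (Fin n)} {β : PM n}
    (h : ∀ x y, e.r x y → β.r (Sum.inl x) (Sum.inl y)) : pmul (fe e) β = β := by
  apply PM_ext
  · exact Lm_le h (fun u v h => by simpa using h)
  · intro u v h
    have := Lm_β (e := e) (c := id) h
    rw [Sum.map_id_id] at this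
    exact this

lemma star_fe (e : Setoid (Fin n)) : star (fe e) = fe e := by
  apply PM_ext <;> intro u v h <;> rcases u with u | u <;> rcases v with v | v <;> exact h

lemma mul_fe {e : Setoid (Fin n)} {β : PM n}
    (h : ∀ x y, e.r x y → β.r (Sum.inr x) (Sum.inr y)) : pmul β (fe e) = β := by
  rw [← star_fe, pmul_star_right, fe_mul, star_star]
  exact h

lemma Phi_fe (e : Setoid (Fin n)) (β : PM n) : Phi (fe e) β = 0 := Phi_Lm _ _ _

lemma Phi_fe' (e : Setoid (Fin n)) (β : PM n) : Phi β (fe e) = 0 := by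
  rw [← star_fe, Phi_star_right, Phi_fe]

/-! ### Working with a congruence -/

section cong
variable {σ : (ℕ × PM n) → (ℕ × PM n) → Prop}

lemma cong_l (hσ : IsCongruence (tmul (n := n)) σ) (δ : PM n) {k m : ℕ} {x y : PM n}
    (h : σ (k, x) (m, y)) : σ (k + Phi δ x, pmul δ x) (m + Phi δ y, pmul δ y) := by
  have := (hσ.2 _ _ (0, δ) h).1
  simpa [tmul] using this

lemma cong_r (hσ : IsCongruence (tmul (n := n)) σ) (δ : PM n) {k m : ℕ} {x y : PM n}
    (h : σ (k, x) (m, y)) : σ (k + Phi x δ, pmul x δ) (m + Phi y δ, pmul y δ) := by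
  have := (hσ.2 _ _ (0, δ) h).2
  simpa [tmul] using this

lemma cong_lvl (hσ : IsCongruence (tmul (n := n)) σ) (j : ℕ) {k m : ℕ} {x y : PM n}
    (h : σ (k, x) (m, y)) : σ (k + j, x) (m + j, y) := by
  have := (hσ.2 _ _ (j, fe ⊥) h).1
  have e : ∀ β : PM n, pmul (fe ⊥) β = β := fun β => fe_mul (by
    intro x y h
    cases (show x = y from h)
    exact β.refl _)
  simpa [tmul, e, Phi_fe, add_comm] using this

lemma cong_L (hσ : IsCongruence (tmul (n := n)) σ) (e : Setoid (Fin n)) (c : Fin n → Fin n)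
    {k m : ℕ} {x y : PM n} (h : σ (k, x) (m, y)) :
    σ (k, pmul (Lm e c) x) (m, pmul (Lm e c) y) := by
  simpa [Phi_Lm] using cong_l hσ (Lm e c) h

lemma cong_T (hσ : IsCongruence (tmul (n := n)) σ) (e : Setoid (Fin n)) (c : Fin n → Fin n)
    (e' : Setoid (Fin n)) (c' : Fin n → Fin n)
    {k m : ℕ} {x y : PM n} (h : σ (k, x) (m, y)) :
    σ (k, Tm e c e' c' x) (m, Tm e c e' c' y) := by
  have := cong_r hσ (star (Lm e' c')) (cong_L hσ e c h)
  rw [Phi_star_right (pmul (Lm e c) x), Phi_star_right (pmul (Lm e c) y), Phi_Lm, Phi_Lm] at this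
  exact this

lemma shift_cong (hσ : IsCongruence (tmul (n := n)) σ) (i : ℕ) :
    IsCongruence (tmul (n := n)) (fun a b => σ (i + a.1, a.2) (i + b.1, b.2)) := by
  refine ⟨⟨fun _ => hσ.1.refl _, fun h => hσ.1.symm h, fun h h' => hσ.1.trans h h'⟩, ?_⟩
  rintro ⟨k, x⟩ ⟨m, y⟩ ⟨j, a⟩ h
  have h1 := (hσ.2 _ _ (j, a) h).1
  have h2 := (hσ.2 _ _ (j, a) h).2
  simp only [tmul] at h1 h2 ⊢
  constructor
  · convert h1 using 2 <;> omega
  · convert h2 using 2 <;> omega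

lemma star_cong (hσ : IsCongruence (tmul (n := n)) σ) :
    IsCongruence (tmul (n := n)) (fun a b => σ (a.1, star a.2) (b.1, star b.2)) := by
  refine ⟨⟨fun _ => hσ.1.refl _, fun h => hσ.1.symm h, fun h h' => hσ.1.trans h h'⟩, ?_⟩
  rintro ⟨k, x⟩ ⟨m, y⟩ ⟨j, a⟩ h
  have h1 := (hσ.2 _ _ (j, star a) h).1
  have h2 := (hσ.2 _ _ (j, star a) h).2
  simp only [tmul, pmul_star, Phi_star] at h1 h2 ⊢
  constructor
  · convert h2 using 2 <;> omega
  · convert h1 using 2 <;> omega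

lemma fe_refl (e : Setoid (Fin n)) (x : Fin n) : (fe e).r (Sum.inl x) (Sum.inr x) :=
  e.refl x

lemma fe_sup (e e' : Setoid (Fin n)) : pmul (fe e) (fe e') = fe (e ⊔ e') := by
  have h1 : e ≤ e ⊔ e' := le_sup_left
  have h2 : e' ≤ e ⊔ e' := le_sup_right
  apply PM_ext
  · apply Lm_le
    · intro x y h; exact h1 h
    · intro u v h
      rcases u with u | u <;> rcases v with v | v <;> exact h2 h
  · have h3 : e ⊔ e' ≤ Setoid.comap Sum.inl (pmul (fe e) (fe e')) := by
      apply sup_le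
      · intro x y h; exact Lm_e h
      · intro x y h
        exact Lm_β (e := e) (c := id) (u := Sum.inl x) (v := Sum.inl y) (β := fe e') h
    have h4 : ∀ x, (pmul (fe e) (fe e')).r (Sum.inl x) (Sum.inr x) := fun x =>
      Lm_β (e := e) (c := id) (u := Sum.inl x) (v := Sum.inr x) (fe_refl e' x)
    intro u v h
    rcases u with u | u <;> rcases v with v | v
    · exact h3 h
    · exact Setoid.trans' _ (h3 h) (h4 v)
    · exact Setoid.trans' _ (Setoid.symm' _ (h4 u)) (h3 h)
    · exact Setoid.trans' _ (Setoid.symm' _ (h4 u)) (Setoid.trans' _ (h3 h) (h4 v))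

instance finSetoid {X : Type*} [Finite X] : Finite (Setoid X) :=
  Finite.of_injective (fun s : Setoid X => s.r) (fun s t h => Setoid.ext fun a b => by
    show s.r a b ↔ t.r a b
    simp only at h
    rw [h])

lemma all_omega (hσ : IsCongruence (tmul (n := n)) σ) (e0 : Setoid (Fin n))
    (h : ∀ x y, ∃ e : Setoid (Fin n), e.r x y ∧ σ (0, fe e0) (0, fe e)) :
    σ (0, fe e0) (0, fe ⊤) := by
  let S : Set (Setoid (Fin n)) := {e | σ (0, fe e0) (0, fe e)}
  have hS : S.Nonempty := ⟨e0, hσ.1.refl _⟩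
  obtain ⟨m, hm⟩ := Set.Finite.exists_maximal (Set.toFinite S) hS
  have : m = ⊤ := by
    rw [Setoid.eq_top_iff]
    intro x y
    obtain ⟨e, hxy, he⟩ := h x y
    have h1 := hm.prop
    have h2 : m ⊔ e ∈ S := by
      have a1 := cong_l hσ (fe m) he
      have a2 := cong_r hσ (fe e0) h1
      simp only [Phi_fe, fe_sup, add_zero] at a1 a2
      rw [sup_idem] at a2
      exact hσ.1.trans a2 a1
    have h3 := hm.le_of_ge h2 le_sup_left
    exact h3 (le_sup_right (a := m) hxy)
  rw [← this]
  exact hm.prop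

lemma stepB_merged (hσ : IsCongruence (tmul (n := n)) σ) (e0 : Setoid (Fin n)) (β : PM n)
    (h : σ (0, fe e0) (0, β)) (hloc : ∀ x y, e0.r x y → β.r (Sum.inl x) (Sum.inl y))
    {x y : Fin n} (hxy : β.r (Sum.inl x) (Sum.inl y)) :
    ∃ e : Setoid (Fin n), e.r x y ∧ σ (0, fe e0) (0, fe e) := by
  refine ⟨Setoid.comap Sum.inl β, hxy, ?_⟩
  have hle : e0 ≤ Setoid.comap Sum.inl β := fun {x y} h => hloc x y h
  have := cong_l hσ (fe (Setoid.comap Sum.inl β)) h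
  rw [Phi_fe, Phi_fe, fe_sup, fe_mul (fun x y h => h), sup_eq_left.2 hle] at this
  exact hσ.1.trans h (hσ.1.symm this)

/-- cut the class `t` -/
def gm {q : ℕ} (p : Fin n → Fin q) (t : Fin q) : PM n :=
  Setoid.ker (Sum.elim (fun x => if p x = t then none else some (p x)) (fun y => some (p y)))

def cutAt {q : ℕ} (p : Fin n → Fin q) (t : Fin q) : V n → Prop :=
  Sum.elim (fun x => p x = t) (fun _ => False)

section cut
variable {q : ℕ} {p : Fin n → Fin q} {t : Fin q} {β : PM n}

lemma gm_top {x y : Fin n} (h : p x = p y) : (gm p t).r (Sum.inl x) (Sum.inl y) := by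
  show _ = _
  simp [h]

lemma gm_bot {x y : Fin n} (h : p x = p y) : (gm p t).r (Sum.inr x) (Sum.inr y) := by
  show _ = _
  simp [h]

lemma gm_tr {x : Fin n} (h : p x ≠ t) : (gm p t).r (Sum.inl x) (Sum.inr x) := by
  show _ = _
  simp [h]

lemma gm_inl {x y : Fin n} (h : (gm p t).r (Sum.inl x) (Sum.inl y)) : p x = p y := by
  have h : (if p x = t then none else some (p x)) = (if p y = t then none else some (p y)) := h
  grind

lemma gm_inr {x y : Fin n} (h : (gm p t).r (Sum.inr x) (Sum.inr y)) : p x = p y := by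
  have h : some (p x) = some (p y) := h
  grind

lemma gm_lr {x y : Fin n} (h : (gm p t).r (Sum.inl x) (Sum.inr y)) : p x = p y ∧ p x ≠ t := by
  have h : (if p x = t then none else some (p x)) = some (p y) := h
  grind

/-- `γ β''` contains `β` as soon as `β ≤ β''`. -/
lemma gm_ge {β'' : PM n}
    (hloc : ∀ x y, p x = p y → β.r (Sum.inl x) (Sum.inl y))
    (hcut : ∀ u v, β.r u v → (cutAt p t u ↔ cutAt p t v))
    (hle : ∀ u v, β.r u v → β''.r u v) :
    ∀ u v, β.r u v → (pmul (gm p t) β'').r u v := by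
  have tm : ∀ x, p x ≠ t → conn (gm p t) β'' (wtop x) (wmid x) := fun x hx =>
    conn_l (u := Sum.inl x) (v := Sum.inr x) (gm_tr hx)
  intro u v h
  rcases u with u | u <;> rcases v with v | v
  · have hc := hcut _ _ h
    simp only [cutAt, Sum.elim_inl] at hc
    by_cases hu : p u = t
    · exact conn_l (u := Sum.inl u) (v := Sum.inl v) (gm_top (hu.trans (hc.1 hu).symm))
    · have hv : p v ≠ t := fun hv => hu (hc.2 hv)
      exact conn_trans (tm u hu) (conn_trans (conn_r (hle _ _ h)) (conn_symm (tm v hv)))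
  · have hc := hcut _ _ h
    simp only [cutAt, Sum.elim_inl, Sum.elim_inr, iff_false] at hc
    exact conn_trans (tm u hc) (conn_r (hle _ _ h))
  · have hc := hcut _ _ h
    simp only [cutAt, Sum.elim_inl, Sum.elim_inr, false_iff] at hc
    exact conn_trans (conn_r (hle _ _ h)) (conn_symm (tm v hc))
  · exact conn_r (hle _ _ h)

open Classical in
lemma gm_mul (hloc : ∀ x y, p x = p y → β.r (Sum.inl x) (Sum.inl y))
    (hcut : ∀ u v, β.r u v → (cutAt p t u ↔ cutAt p t v)) (ht : ∃ x, p x = t) :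
    pmul (gm p t) β = β ∧ Phi (gm p t) β = 1 := by
  let F : W n → Option (Quotient β) := Sum.elim (fun x => some (Quotient.mk β (Sum.inl x)))
    (Sum.elim (fun x => if p x = t then none else some (Quotient.mk β (Sum.inl x)))
      (fun y => some (Quotient.mk β (Sum.inr y))))
  have q1 : ∀ x y, p x = p y → Quotient.mk β (Sum.inl x) = Quotient.mk β (Sum.inl y) :=
    fun x y h => Quotient.sound (hloc x y h)
  have hF : ∀ x y, conn (gm p t) β x y → F x = F y := by
    intro x y h
    refine conn_le F ?_ ?_ h
    · intro u v h
      rcases u with u | u <;> rcases v with v | v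
      · exact congrArg some (q1 _ _ (gm_inl h))
      · have := gm_lr h
        simp only [F, topMid, Sum.elim_inl, Sum.elim_inr]
        rw [if_neg (by rw [← this.1]; exact this.2), q1 _ _ this.1]
      · have := gm_lr (Setoid.symm' _ h)
        simp only [F, topMid, Sum.elim_inl, Sum.elim_inr]
        rw [if_neg (by rw [← this.1]; exact this.2), q1 _ _ this.1]
      · have := gm_inr h
        simp only [F, topMid, Sum.elim_inl, Sum.elim_inr]
        rw [this, q1 _ _ this]
    · intro u v h
      have hc := hcut _ _ h
      have hq : Quotient.mk β u = Quotient.mk β v := Quotient.sound h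
      rcases u with u | u <;> rcases v with v | v <;>
        simp only [F, midBot, Sum.elim_inl, Sum.elim_inr, cutAt, iff_false, false_iff] at hc ⊢ <;>
        simp [hc, hq]
  constructor
  · apply PM_ext
    · intro u v h
      have := hF _ _ h
      rcases u with u | u <;> rcases v with v | v <;>
        exact Quotient.exact (Option.some_injective _ this)
    · exact gm_ge hloc hcut (fun _ _ h => h)
  · obtain ⟨x0, hx0⟩ := ht
    refine Phi_one x0 ?_ ?_
    · intro v hv
      have := hF _ _ hv
      rcases v with v | v <;> simp [F, topBot, hx0] at this
    · intro m'
      by_cases h : p m' = t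
      · left
        exact conn_l (u := Sum.inr x0) (v := Sum.inr m') (gm_bot (hx0.trans h.symm))
      · right
        exact ⟨Sum.inl m', conn_l (u := Sum.inr m') (v := Sum.inl m') (Setoid.symm' _ (gm_tr h))⟩

open Classical in
lemma gm_tau_mul (hloc : ∀ x y, p x = p y → β.r (Sum.inl x) (Sum.inl y))
    (hcut : ∀ u v, β.r u v → (cutAt p t u ↔ cutAt p t v)) (s0 : Fin n) (hs : p s0 ≠ t)
    (e2 : Setoid (Fin n))
    (he2 : e2 = Setoid.ker (fun x => if p x = t then p s0 else p x)) :
    pmul (gm p t) (pmul (fe e2) β) = β ∧ Phi (gm p t) (pmul (fe e2) β) = 0 := by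
  let G : Fin n → Fin n := fun x => if p x = t then s0 else x
  let F : W n → Quotient β := Sum.elim (fun x => Quotient.mk β (Sum.inl x))
    (Sum.elim (fun x => Quotient.mk β (Sum.inl (G x)))
      (fun y => Quotient.mk β (Sum.inr y)))
  have q1 : ∀ x y, p x = p y → Quotient.mk β (Sum.inl x) = Quotient.mk β (Sum.inl y) :=
    fun x y h => Quotient.sound (hloc x y h)
  have e2' : ∀ x y, e2.r x y ↔ p (G x) = p (G y) := by
    intro x y
    rw [he2]
    show (if p x = t then p s0 else p x) = (if p y = t then p s0 else p y) ↔ _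
    simp only [G]
    split_ifs <;> simp
  have hF : ∀ x y, conn (gm p t) (pmul (fe e2) β) x y → F x = F y := by
    intro x y h
    refine conn_le F ?_ ?_ h
    · intro u v h
      rcases u with u | u <;> rcases v with v | v
      · exact q1 _ _ (gm_inl h)
      · have := gm_lr h
        simp only [F, G, topMid, Sum.elim_inl, Sum.elim_inr]
        rw [if_neg (by rw [← this.1]; exact this.2), q1 _ _ this.1]
      · have := gm_lr (Setoid.symm' _ h)
        simp only [F, G, topMid, Sum.elim_inl, Sum.elim_inr]
        rw [if_neg (by rw [← this.1]; exact this.2), q1 _ _ this.1]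
      · have := gm_inr h
        simp only [F, G, topMid, Sum.elim_inl, Sum.elim_inr]
        apply q1
        grind
    · have : ∀ u v, (pmul (fe e2) β).r u v → (Setoid.ker (fun w => F (midBot w))).r u v := by
        apply Lm_le
        · intro x y h
          exact q1 _ _ ((e2' x y).1 h)
        · intro u v h
          have hc := hcut _ _ h
          have hq : Quotient.mk β u = Quotient.mk β v := Quotient.sound h
          show F _ = F _
          rcases u with u | u <;> rcases v with v | v <;>
            simp only [F, G, midBot, Sum.map_inl, Sum.map_inr, id,
              Sum.elim_inl, Sum.elim_inr, cutAt] at hc ⊢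
          · by_cases hu : p u = t
            · simp [hu, hc.1 hu]
            · rw [if_neg hu, if_neg (fun h => hu (hc.2 h)), hq]
          · simp at hc; simp [hc, hq]
          · simp at hc; simp [hc, hq]
          · exact hq
      exact this
  have hle : ∀ u v, β.r u v → (pmul (fe e2) β).r u v := by
    intro u v h
    have := Lm_β (e := e2) (c := id) h
    rw [Sum.map_id_id] at this
    exact this
  constructor
  · apply PM_ext
    · intro u v h
      have := hF _ _ h
      rcases u with u | u <;> rcases v with v | v <;> exact Quotient.exact this
    · exact gm_ge hloc hcut hle
  · apply Phi_zero
    intro m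
    have tm : ∀ x, p x ≠ t → conn (gm p t) (pmul (fe e2) β) (wmid x) (wtop x) := fun x hx =>
      conn_l (u := Sum.inr x) (v := Sum.inl x) (Setoid.symm' _ (gm_tr hx))
    by_cases h : p m = t
    · refine ⟨Sum.inl s0, conn_trans ?_ (tm s0 hs)⟩
      have : e2.r m s0 := by
        rw [e2']
        simp only [G]
        grind
      exact conn_r (u := Sum.inl m) (v := Sum.inl s0) (Lm_e this)
    · exact ⟨Sum.inl m, tm m h⟩

lemma stepB_cut (hσ : IsCongruence (tmul (n := n)) σ)
    (hloc : ∀ x y, p x = p y → β.r (Sum.inl x) (Sum.inl y))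
    (h : σ (0, fe (Setoid.ker p)) (0, β))
    (hcut : ∀ u v, β.r u v → (cutAt p t u ↔ cutAt p t v)) (t0 s0 : Fin n) (ht : p t0 = t)
    (hs : p s0 ≠ t) :
    ∃ e : Setoid (Fin n), e.r t0 s0 ∧ σ (0, fe (Setoid.ker p)) (0, fe e) := by
  classical
  obtain ⟨e2, he2⟩ : ∃ e2 : Setoid (Fin n),
    e2 = Setoid.ker (fun x => if p x = t then p s0 else p x) := ⟨_, rfl⟩
  refine ⟨e2, ?_, ?_⟩
  · rw [he2]
    show (if p t0 = t then p s0 else p t0) = (if p s0 = t then p s0 else p s0)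
    simp [ht]
  have hle : Setoid.ker p ≤ e2 := by
    rw [he2]
    intro x y hxy
    have hxy : p x = p y := hxy
    show (if p x = t then p s0 else p x) = (if p y = t then p s0 else p y)
    rw [hxy]
  obtain ⟨g1, g2⟩ := gm_mul hloc hcut ⟨t0, ht⟩
  obtain ⟨g3, g4⟩ := gm_tau_mul hloc hcut s0 hs e2 he2
  have gf : pmul (gm p t) (fe (Setoid.ker p)) = gm p t := mul_fe (fun x y h => gm_bot h)
  have h1 := cong_l hσ (gm p t) h
  rw [Phi_fe', gf, g1, g2] at h1
  have h2 := hσ.1.trans h1 (hσ.1.symm (cong_lvl hσ 1 h))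
  have h3 := cong_l hσ (fe e2) h
  rw [Phi_fe, Phi_fe, fe_sup, sup_eq_left.2 hle] at h3
  have h4 := cong_l hσ (gm p t) h3
  rw [g3] at h4
  simp only [Phi_fe', g4, add_zero] at h4
  have h5 := cong_r hσ (fe e2) h2
  rw [fe_sup, sup_eq_right.2 hle] at h5
  simp only [Phi_fe', add_zero, zero_add] at h5
  have h6 := hσ.1.trans h (hσ.1.trans (hσ.1.symm h4) h5)
  have h7 := cong_l hσ (fe e2) h6
  rw [fe_sup, sup_eq_left.2 hle, fe_sup, sup_idem] at h7
  simp only [Phi_fe, add_zero] at h7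
  exact hσ.1.trans h6 (hσ.1.symm h7)

end cut
end cong

/-! ### From `fe e ~ ω` down to rank zero -/

section down
variable {σ : (ℕ × PM n) → (ℕ × PM n) → Prop}

def Ym (A : Fin n → Prop) : PM n := Setoid.ker (Sum.elim (fun x => A x) (fun _ => False))

def Dm : PM n := Setoid.ker (Sum.elim (fun _ => True) (fun _ => False))

lemma fe_top_r (u v : V n) : (fe (⊤ : Setoid (Fin n))).r u v := trivial

lemma eq_fe_top {x : PM n} (h : ∀ u v, x.r u v) : x = fe ⊤ :=
  PM_ext (fun _ _ _ => trivial) (fun u v _ => h u v)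

lemma top_mul_Ym {A : Fin n → Prop} {x1 : Fin n} (h1 : ¬ A x1) :
    pmul (fe ⊤) (Ym A) = fe ⊤ := by
  apply eq_fe_top
  have a : ∀ x, (pmul (fe ⊤) (Ym A)).r (Sum.inl x) (Sum.inl x1) := fun x => Lm_e trivial
  have b : ∀ y, (pmul (fe ⊤) (Ym A)).r (Sum.inr y) (Sum.inl x1) := fun y =>
    Lm_β (u := Sum.inr y) (v := Sum.inl x1) (c := id) (by
      show False = A x1
      simp [h1])
  have c : ∀ u, (pmul (fe ⊤) (Ym A)).r u (Sum.inl x1) := by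
    rintro (u | u)
    · exact a u
    · exact b u
  exact fun u v => Setoid.trans' _ (c u) (Setoid.symm' _ (c v))

lemma Ym_sim (hσ : IsCongruence (tmul (n := n)) σ) {A : Fin n → Prop} {x1 : Fin n}
    (h1 : ¬ A x1) (h : σ (0, fe (Setoid.ker A)) (0, fe ⊤)) : σ (0, Ym A) (0, fe ⊤) := by
  have := cong_r hσ (Ym A) h
  rw [Phi_fe, Phi_fe, top_mul_Ym h1, fe_mul] at this
  · exact this
  · intro x y h
    exact h

lemma Xm_sim (hσ : IsCongruence (tmul (n := n)) σ) {A : Fin n → Prop} {x1 : Fin n}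
    (h1 : ¬ A x1) (h : σ (0, fe (Setoid.ker A)) (0, fe ⊤)) : σ (0, star (Ym A)) (0, fe ⊤) := by
  have := Ym_sim (star_cong hσ) h1 (by
    show σ (0, star _) (0, star _)
    rw [star_fe, star_fe]; exact h)
  have : σ (0, star _) (0, star _) := this
  rwa [star_fe] at this

lemma XY_one {A : Fin n → Prop} {x0 x1 : Fin n} (h0 : A x0) (h1 : ¬ A x1) :
    pmul (star (Ym A)) (Ym A) = fe ⊤ ∧ Phi (star (Ym A)) (Ym A) = 1 := by
  let F : W n → Prop := Sum.elim (fun _ => False) (Sum.elim A (fun _ => False))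
  have hF : ∀ x y, conn (star (Ym A)) (Ym A) x y → F x = F y := by
    intro x y h
    refine conn_le F ?_ ?_ h
    · intro u v h
      rcases u with u | u <;> rcases v with v | v <;> exact h
    · intro u v h
      rcases u with u | u <;> rcases v with v | v <;> exact h
  have a : ∀ x m, ¬ A m → conn (star (Ym A)) (Ym A) (wtop x) (wmid m) := fun x m hm =>
    conn_l (u := Sum.inl x) (v := Sum.inr m) (by show False = A m; simp [hm])
  have b : ∀ x m, ¬ A m → conn (star (Ym A)) (Ym A) (wbot x) (wmid m) := fun x m hm =>
    conn_r (u := Sum.inr x) (v := Sum.inl m) (by show False = A m; simp [hm])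
  constructor
  · apply eq_fe_top
    intro u v
    have c : ∀ u, conn (star (Ym A)) (Ym A) (topBot u) (wmid x1) := by
      rintro (u | u)
      · exact a u x1 h1
      · exact b u x1 h1
    exact conn_trans (c u) (conn_symm (c v))
  · refine Phi_one x0 ?_ ?_
    · intro v hv
      have := hF _ _ hv
      rcases v with v | v <;> simp [F, topBot, h0] at this
    · intro m'
      by_cases h : A m'
      · left
        exact conn_r (u := Sum.inl x0) (v := Sum.inl m') (by show A x0 = A m'; simp [h0, h])
      · right
        exact ⟨Sum.inl m', conn_symm (a m' m' h)⟩

lemma XY_zero {A : Fin n → Prop} {x0 x1 : Fin n} (h0 : A x0) (h1 : ¬ A x1) :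
    pmul (star (Ym (fun x => ¬ A x))) (Ym A) = Dm ∧
      Phi (star (Ym (fun x => ¬ A x))) (Ym A) = 0 := by
  let F : W n → Prop := Sum.elim (fun _ => True) (Sum.elim A (fun _ => False))
  have hF : ∀ x y, conn (star (Ym (fun x => ¬ A x))) (Ym A) x y → F x = F y := by
    intro x y h
    refine conn_le F ?_ ?_ h
    · intro u v h
      rcases u with u | u <;> rcases v with v | v
      · rfl
      · have h : False = ¬ A v := h
        show True = A v
        by_cases hA : A v <;> simp [hA] at h ⊢
      · have h : (¬ A u) = False := h
        show A u = True
        by_cases hA : A u <;> simp [hA] at h ⊢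
      · have h : (¬ A u) = ¬ A v := h
        show A u = A v
        exact propext (not_iff_not.1 (iff_of_eq h))
    · intro u v h
      rcases u with u | u <;> rcases v with v | v <;> exact h
  have a : ∀ x m, A m → conn (star (Ym (fun x => ¬ A x))) (Ym A) (wtop x) (wmid m) :=
    fun x m hm =>
    conn_l (u := Sum.inl x) (v := Sum.inr m) (by show False = ¬ A m; simp [hm])
  have b : ∀ x m, ¬ A m → conn (star (Ym (fun x => ¬ A x))) (Ym A) (wbot x) (wmid m) :=
    fun x m hm =>
    conn_r (u := Sum.inr x) (v := Sum.inl m) (by show False = A m; simp [hm])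
  constructor
  · apply PM_ext
    · intro u v h
      have := hF _ _ h
      rcases u with u | u <;> rcases v with v | v <;> exact this
    · intro u v h
      rcases u with u | u <;> rcases v with v | v
      · exact conn_trans (a u x0 h0) (conn_symm (a v x0 h0))
      · have h : True = False := h
        simp at h
      · have h : False = True := h
        simp at h
      · exact conn_trans (b u x1 h1) (conn_symm (b v x1 h1))
  · refine Phi_zero ?_
    intro m'
    by_cases h : A m'
    · exact ⟨Sum.inl m', conn_symm (a m' m' h)⟩
    · exact ⟨Sum.inr m', conn_symm (b m' m' h)⟩

lemma omega_Dm (hσ : IsCongruence (tmul (n := n)) σ) {A : Fin n → Prop} {x0 x1 : Fin n}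
    (h0 : A x0) (h1 : ¬ A x1) (h : σ (0, fe (Setoid.ker A)) (0, fe ⊤)) (k : ℕ) :
    σ (k, fe ⊤) (0, Dm) := by
  have hk : Setoid.ker (fun x => ¬ A x) = Setoid.ker A := by
    ext x y
    show (¬ A x) = (¬ A y) ↔ A x = A y
    rw [eq_iff_iff, eq_iff_iff]
    exact not_iff_not
  have e0 : σ (0, Dm) (0, fe ⊤) := by
    have a := Xm_sim hσ (A := fun x => ¬ A x) (x1 := x0) (by simpa using h0) (by rw [hk]; exact h)
    have b := cong_r hσ (Ym A) a
    rw [(XY_zero h0 h1).1, (XY_zero h0 h1).2, Phi_fe, top_mul_Ym h1] at b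
    exact b
  have e1 : σ (1, fe ⊤) (0, fe ⊤) := by
    have b := cong_r hσ (Ym A) (Xm_sim hσ h1 h)
    rw [(XY_one h0 h1).1, (XY_one h0 h1).2, Phi_fe, top_mul_Ym h1] at b
    exact b
  refine hσ.1.trans ?_ (hσ.1.symm e0)
  induction k with
  | zero => exact hσ.1.refl _
  | succ k ih =>
    have := cong_lvl hσ 1 ih
    exact hσ.1.trans this (by simpa using e1)

def NT (x : PM n) : Prop := ∀ u v, ¬ x.r (Sum.inl u) (Sum.inr v)

lemma NT_star {x : PM n} (h : NT x) : NT (star x) := fun u v h' => h v u (Setoid.symm' _ h')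

open Classical in
lemma C2_step (hσ : IsCongruence (tmul (n := n)) σ) {A : Fin n → Prop} {x0 x1 : Fin n}
    (h0 : A x0) (h1 : ¬ A x1) (h : σ (0, fe (Setoid.ker A)) (0, fe ⊤)) (k : ℕ) (x : PM n)
    (hx : NT x) (y1 y2 : Fin n) :
    ∃ x' : PM n, NT x' ∧ x ≤ x' ∧ x'.r (Sum.inl y1) (Sum.inl y2) ∧ σ (k, x) (k, x') := by
  obtain ⟨v, hv⟩ : ∃ v : PM n, v = Setoid.ker (Sum.elim (fun j => Sum.inl (A j))
    (fun y => Sum.inr (Quotient.mk x (Sum.inr y)))) := ⟨_, rfl⟩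
  have vll : ∀ j j', v.r (Sum.inl j) (Sum.inl j') ↔ A j = A j' := by
    intro j j'
    rw [hv]
    exact Sum.inl_injective.eq_iff
  have vlr : ∀ j j', ¬ v.r (Sum.inl j) (Sum.inr j') := by
    intro j j' h
    rw [hv] at h
    cases (show Sum.inl _ = Sum.inr _ from h)
  have vrr : ∀ j j', v.r (Sum.inr j) (Sum.inr j') ↔ x.r (Sum.inr j) (Sum.inr j') := by
    intro j j'
    rw [hv]
    exact Sum.inr_injective.eq_iff.trans Quotient.eq
  clear hv
  let c : Fin n → Fin n := fun j => if A j then y1 else y2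
  have hc : ∀ j j', A j = A j' → c j = c j' := by
    intro j j' h
    simp only [c, h]
  have e1 : pmul (Lm (Setoid.comap Sum.inl x) c) v = x := by
    apply PM_ext
    · apply Lm_le
      · intro a b h; exact h
      · intro u w h
        rcases u with u | u <;> rcases w with w | w
        · simp only [Sum.map_inl]
          rw [hc _ _ ((vll _ _).1 h)]
        · exact absurd h (vlr _ _)
        · exact absurd (Setoid.symm' _ h) (vlr _ _)
        · exact (vrr _ _).1 h
    · intro u w h
      rcases u with u | u <;> rcases w with w | w
      · exact Lm_e h
      · exact absurd h (hx _ _)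
      · exact absurd (Setoid.symm' _ h) (hx _ _)
      · exact Lm_β (u := Sum.inr u) (v := Sum.inr w) ((vrr _ _).2 h)
  have e2 : pmul (fe (Setoid.ker A)) v = v := fe_mul fun a b h => (vll _ _).2 h
  have s := cong_r hσ v h
  rw [Phi_fe, Phi_fe, e2] at s
  have s := cong_L hσ (Setoid.comap Sum.inl x) c s
  rw [e1] at s
  have s := cong_lvl hσ k s
  simp only [zero_add, add_zero] at s
  refine ⟨_, ?_, ?_, ?_, s⟩
  · intro a b hab
    have i1 : ∀ u w, (pmul (fe ⊤) v).r u w → (Setoid.ker Sum.isLeft).r u w := by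
      apply Lm_le
      · intro a b _; rfl
      · intro u w h
        rcases u with u | u <;> rcases w with w | w
        · rfl
        · exact absurd h (vlr _ _)
        · exact absurd (Setoid.symm' _ h) (vlr _ _)
        · rfl
    have i2 : ∀ u w, (pmul (Lm (Setoid.comap Sum.inl x) c) (pmul (fe ⊤) v)).r u w →
        (Setoid.ker Sum.isLeft).r u w := by
      apply Lm_le
      · intro a b _; rfl
      · intro u w h
        have := i1 u w h
        rcases u with u | u <;> rcases w with w | w <;> exact this
    have := i2 _ _ hab
    cases (show true = false from this)
  · intro u w h
    rcases u with u | u <;> rcases w with w | w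
    · exact Lm_e h
    · exact absurd h (hx _ _)
    · exact absurd (Setoid.symm' _ h) (hx _ _)
    · exact Lm_β (u := Sum.inr u) (v := Sum.inr w)
        (Lm_β (u := Sum.inr u) (v := Sum.inr w) ((vrr _ _).2 h))
  · have := Lm_β (e := Setoid.comap Sum.inl x) (c := c) (u := Sum.inl x0) (v := Sum.inl x1)
      (β := pmul (fe ⊤) v) (Lm_e trivial)
    simpa [c, h0, h1] using this

lemma C2_step' (hσ : IsCongruence (tmul (n := n)) σ) {A : Fin n → Prop} {x0 x1 : Fin n}
    (h0 : A x0) (h1 : ¬ A x1) (h : σ (0, fe (Setoid.ker A)) (0, fe ⊤)) (k : ℕ) (x : PM n)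
    (hx : NT x) (y1 y2 : Fin n) :
    ∃ x' : PM n, NT x' ∧ x ≤ x' ∧ x'.r (Sum.inr y1) (Sum.inr y2) ∧ σ (k, x) (k, x') := by
  obtain ⟨x', a, b, c, d⟩ := C2_step (star_cong hσ) h0 h1 (by
    show σ (0, star _) (0, star _)
    rw [star_fe, star_fe]; exact h) k (star x) (NT_star hx) y1 y2
  refine ⟨star x', NT_star a, ?_, c, ?_⟩
  · intro u v h
    exact b (show (star x).r u.swap v.swap by
      rw [star_r, Sum.swap_swap, Sum.swap_swap]; exact h)
  · have d : σ (k, star (star x)) (k, star x') := d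
    rwa [star_star] at d

lemma NT_Dm (hσ : IsCongruence (tmul (n := n)) σ) {A : Fin n → Prop} {x0 x1 : Fin n}
    (h0 : A x0) (h1 : ¬ A x1) (h : σ (0, fe (Setoid.ker A)) (0, fe ⊤)) (k : ℕ) (x : PM n)
    (hx : NT x) : σ (k, x) (0, Dm) := by
  let S : Set (PM n) := {y | NT y ∧ σ (k, x) (k, y)}
  have hS : S.Nonempty := ⟨x, hx, hσ.1.refl _⟩
  obtain ⟨m, hm⟩ := Set.Finite.exists_maximal (Set.toFinite S) hS
  have hl : ∀ y1 y2, m.r (Sum.inl y1) (Sum.inl y2) := by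
    intro y1 y2
    obtain ⟨x', a, b, c, d⟩ := C2_step hσ h0 h1 h k m hm.prop.1 y1 y2
    exact hm.le_of_ge ⟨a, hσ.1.trans hm.prop.2 d⟩ b c
  have hr : ∀ y1 y2, m.r (Sum.inr y1) (Sum.inr y2) := by
    intro y1 y2
    obtain ⟨x', a, b, c, d⟩ := C2_step' hσ h0 h1 h k m hm.prop.1 y1 y2
    exact hm.le_of_ge ⟨a, hσ.1.trans hm.prop.2 d⟩ b c
  have hD : m = Dm := by
    apply PM_ext
    · intro u w h
      rcases u with u | u <;> rcases w with w | w
      · rfl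
      · exact absurd h (hm.prop.1 _ _)
      · exact absurd (Setoid.symm' _ h) (hm.prop.1 _ _)
      · rfl
    · intro u w h
      rcases u with u | u <;> rcases w with w | w
      · exact hl _ _
      · have h : True = False := h
        simp at h
      · have h : False = True := h
        simp at h
      · exact hr _ _
  have s1 : σ (k, x) (k, Dm) := hD ▸ hm.prop.2
  have s2 := omega_Dm hσ h0 h1 h k
  have s3 := cong_lvl hσ k (omega_Dm hσ h0 h1 h 0)
  simp only [zero_add] at s3
  exact hσ.1.trans s1 (hσ.1.trans (hσ.1.symm s3) s2)

end down
/-! ### Ranks and factorisations -/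

section rank

lemma rep {α : PM n} {q : ℕ} (h : rnk α = q) : ∃ a b : Fin q → Fin n,
    (∀ s t, α.r (Sum.inl (a s)) (Sum.inl (a t)) → s = t) ∧
    (∀ s, α.r (Sum.inl (a s)) (Sum.inr (b s))) ∧
    (∀ u v, α.r (Sum.inl u) (Sum.inr v) → ∃ s, α.r (Sum.inl u) (Sum.inl (a s))) := by
  let E := (Finite.equivFinOfCardEq h).symm
  choose a ha using fun s => (E s).2.1
  choose b hb using fun s => (E s).2.2
  refine ⟨a, b, ?_, ?_, ?_⟩
  · intro s t hst
    apply E.injective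
    apply Subtype.ext
    rw [← ha, ← ha]
    exact Quotient.sound hst
  · intro s
    exact Quotient.exact ((ha s).trans (hb s).symm)
  · intro u v huv
    refine ⟨E.symm ⟨Quotient.mk α (Sum.inl u), ⟨u, rfl⟩, ⟨v, (Quotient.sound huv).symm⟩⟩, ?_⟩
    apply Quotient.exact (s := α)
    rw [ha, Equiv.apply_symm_apply]

lemma rnk_le_of_cover {α : PM n} {q : ℕ} (a : Fin q → Fin n)
    (h : ∀ u v, α.r (Sum.inl u) (Sum.inr v) → ∃ s, α.r (Sum.inl u) (Sum.inl (a s))) :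
    rnk α ≤ q := by
  have key : ∀ c : {c : Quotient α //
      (∃ i : Fin n, Quotient.mk α (Sum.inl i) = c) ∧ ∃ i : Fin n, Quotient.mk α (Sum.inr i) = c},
      ∃ s, Quotient.mk α (Sum.inl (a s)) = c.1 := by
    rintro ⟨c, ⟨u, rfl⟩, ⟨v, hv⟩⟩
    obtain ⟨s, hs⟩ := h u v (Quotient.exact hv.symm)
    exact ⟨s, (Quotient.sound hs).symm⟩
  choose f hf using key
  have : Function.Injective f := by
    intro c d hcd
    apply Subtype.ext
    rw [← hf, ← hf, hcd]
  have := Nat.card_le_card_of_injective f this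
  simpa [rnk] using this

lemma cover_of_rnk {α : PM n} {q : ℕ} (hq : rnk α ≤ q) (a b : Fin q → Fin n)
    (h1 : ∀ s t, α.r (Sum.inl (a s)) (Sum.inl (a t)) → s = t)
    (h2 : ∀ s, α.r (Sum.inl (a s)) (Sum.inr (b s))) :
    ∀ u v, α.r (Sum.inl u) (Sum.inr v) → ∃ s, α.r (Sum.inl u) (Sum.inl (a s)) := by
  let f : Fin q → {c : Quotient α //
      (∃ i : Fin n, Quotient.mk α (Sum.inl i) = c) ∧ ∃ i : Fin n, Quotient.mk α (Sum.inr i) = c} :=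
    fun s => ⟨Quotient.mk α (Sum.inl (a s)), ⟨_, rfl⟩, ⟨b s, (Quotient.sound (h2 s)).symm⟩⟩
  have hf : Function.Injective f := by
    intro s t hst
    exact h1 _ _ (Quotient.exact (Subtype.ext_iff.1 hst))
  have hb := hf.bijective_of_nat_card_le (by simpa [rnk] using hq)
  intro u v huv
  obtain ⟨s, hs⟩ := hb.2 ⟨Quotient.mk α (Sum.inl u), ⟨u, rfl⟩, ⟨v, (Quotient.sound huv).symm⟩⟩
  exact ⟨s, Setoid.symm' _ (Quotient.exact (Subtype.ext_iff.1 hs))⟩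

lemma rnk_ge_of_inj {α : PM n} {q : ℕ} (a b : Fin q → Fin n)
    (h1 : ∀ s t, α.r (Sum.inl (a s)) (Sum.inl (a t)) → s = t)
    (h2 : ∀ s, α.r (Sum.inl (a s)) (Sum.inr (b s))) : q ≤ rnk α := by
  let f : Fin q → {c : Quotient α //
      (∃ i : Fin n, Quotient.mk α (Sum.inl i) = c) ∧ ∃ i : Fin n, Quotient.mk α (Sum.inr i) = c} :=
    fun s => ⟨Quotient.mk α (Sum.inl (a s)), ⟨_, rfl⟩, ⟨b s, (Quotient.sound (h2 s)).symm⟩⟩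
  have hf : Function.Injective f := by
    intro s t hst
    exact h1 _ _ (Quotient.exact (Subtype.ext_iff.1 hst))
  have := Nat.card_le_card_of_injective f hf
  simpa [rnk] using this

lemma NT_of_rnk {α : PM n} (h : rnk α = 0) : NT α := by
  obtain ⟨a, b, -, -, h⟩ := rep h
  intro u v huv
  exact (h u v huv).elim (fun s => s.elim0)

lemma rep_le {α : PM n} {q : ℕ} (h : rnk α ≤ q) (h1 : rnk α ≠ 0) : ∃ a b : Fin q → Fin n,
    (∀ s, α.r (Sum.inl (a s)) (Sum.inr (b s))) ∧
    (∀ u v, α.r (Sum.inl u) (Sum.inr v) → ∃ s, α.r (Sum.inl u) (Sum.inl (a s))) := by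
  obtain ⟨a, b, -, h2, h3⟩ := rep (α := α) rfl
  let f : Fin q → Fin (rnk α) := fun s => ⟨min s (rnk α - 1), by omega⟩
  refine ⟨a ∘ f, b ∘ f, fun s => h2 _, ?_⟩
  intro u v huv
  obtain ⟨s, hs⟩ := h3 u v huv
  refine ⟨⟨s, by omega⟩, ?_⟩
  have : f ⟨s, by omega⟩ = s := by
    apply Fin.ext
    simp only [f]
    omega
  simpa [this] using hs

lemma trans_of_mul {x b : PM n} {u v : Fin n} (h : (pmul x b).r (Sum.inl u) (Sum.inr v)) :
    ∃ z w, x.r (Sum.inl z) (Sum.inr w) ∧ (pmul x b).r (Sum.inl u) (Sum.inl z) := by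
  by_contra hcon
  push Not at hcon
  let F : W n → Prop := Sum.elim (fun z => (pmul x b).r (Sum.inl u) (Sum.inl z)) (fun _ => False)
  have := conn_le (α := x) (β := b) F ?_ ?_ h
  · have : (pmul x b).r (Sum.inl u) (Sum.inl u) = False := this
    rw [← this]
  · intro a c hac
    rcases a with a | a <;> rcases c with c | c
    · have : (pmul x b).r (Sum.inl a) (Sum.inl c) := conn_l (u := Sum.inl a) (v := Sum.inl c) hac
      apply propext
      exact ⟨fun h => Setoid.trans' _ h this,
        fun h => Setoid.trans' _ h (Setoid.symm' _ this)⟩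
    · exact eq_false (hcon _ _ hac)
    · exact (eq_false (hcon _ _ (Setoid.symm' _ hac))).symm
    · rfl
  · intro a c hac
    rcases a with a | a <;> rcases c with c | c <;> rfl

lemma rnk_mul_left (x b : PM n) : rnk (pmul x b) ≤ rnk x := by
  obtain ⟨a, c, -, h2, h3⟩ := rep (α := x) rfl
  refine rnk_le_of_cover a ?_
  intro u v h
  obtain ⟨z, w, hz, hu⟩ := trans_of_mul h
  obtain ⟨s, hs⟩ := h3 z w hz
  exact ⟨s, Setoid.trans' _ hu (conn_l (u := Sum.inl z) (v := Sum.inl (a s)) hs)⟩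

lemma rnk_mul_right (x b : PM n) : rnk (pmul x b) ≤ rnk b := by
  rw [← rnk_star, ← pmul_star, ← rnk_star b]
  exact rnk_mul_left _ _

lemma ideal_rnk (i q : ℕ) : tIdeal n {a | i ≤ a.1 ∧ rnk a.2 ≤ q} := by
  rintro ⟨j, a⟩ ⟨k, b⟩ ⟨m, x⟩ ⟨h1, h2⟩
  show i ≤ _ ∧ rnk _ ≤ q
  simp only [tmul] at h1 h2 ⊢
  refine ⟨by omega, ?_⟩
  exact (rnk_mul_left _ _).trans ((rnk_mul_right _ _).trans h2)

end rank

section fact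
variable {q : ℕ} {p : Fin n → Fin q}

def fpi (p : Fin n → Fin q) (π : Equiv.Perm (Fin q)) : PM n :=
  Setoid.ker (Sum.elim (fun x => π (p x)) p)

lemma fpi_one : fpi p 1 = fe (Setoid.ker p) := by
  apply PM_ext <;> intro u v h <;> rcases u with u | u <;> rcases v with v | v <;> exact h

lemma fpi_mul (hp : Function.Surjective p) (π ρ : Equiv.Perm (Fin q)) :
    pmul (fpi p π) (fpi p ρ) = fpi p (ρ * π) ∧ Phi (fpi p π) (fpi p ρ) = 0 := by
  let F : W n → Fin q := Sum.elim (fun x => ρ (π (p x))) (Sum.elim (fun m => ρ (p m)) p)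
  have hF : ∀ x y, conn (fpi p π) (fpi p ρ) x y → F x = F y := by
    intro x y h
    refine conn_le F ?_ ?_ h
    · intro u v h
      rcases u with u | u <;> rcases v with v | v <;> exact congrArg ρ h
    · intro u v h
      rcases u with u | u <;> rcases v with v | v <;> exact h
  have a : ∀ x m, π (p x) = p m → conn (fpi p π) (fpi p ρ) (wtop x) (wmid m) := fun x m h =>
    conn_l (u := Sum.inl x) (v := Sum.inr m) h
  have b : ∀ y m, p y = ρ (p m) → conn (fpi p π) (fpi p ρ) (wbot y) (wmid m) := fun x m h =>
    conn_r (u := Sum.inr x) (v := Sum.inl m) h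
  have c : ∀ u m, F (topBot u) = ρ (p m) → conn (fpi p π) (fpi p ρ) (topBot u) (wmid m) := by
    rintro (u | u) m h
    · exact a u m (ρ.injective h)
    · exact b u m h
  constructor
  · apply PM_ext
    · intro u v h
      have := hF _ _ h
      rcases u with u | u <;> rcases v with v | v <;> exact this
    · intro u v h
      have h : F (topBot u) = F (topBot v) := by
        rcases u with u | u <;> rcases v with v | v <;> exact h
      obtain ⟨m, hm⟩ := hp (ρ.symm (F (topBot v)))
      have hm : F (topBot v) = ρ (p m) := by rw [hm, Equiv.apply_symm_apply]
      exact conn_trans (c u m (h.trans hm)) (conn_symm (c v m hm))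
  · apply Phi_zero
    intro m
    obtain ⟨x, hx⟩ := hp (π.symm (p m))
    exact ⟨Sum.inl x, conn_symm (a x m (by rw [hx, Equiv.apply_symm_apply]))⟩

lemma collapse (hp : Function.Surjective p) (l l' : Fin n → Fin q) (π : Equiv.Perm (Fin q))
    (α : PM n) (h1 : ∀ x y, α.r (Sum.inl x) (Sum.inl y) → l x = l y)
    (h2 : ∀ x y, α.r (Sum.inr x) (Sum.inr y) → l' x = l' y)
    (h3 : ∀ x y, α.r (Sum.inl x) (Sum.inr y) → π (l x) = l' y)
    (h4 : ∀ t, ∃ x y, α.r (Sum.inl x) (Sum.inr y) ∧ l x = t) :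
    Tm (Setoid.ker p) (Function.surjInv hp ∘ l) (Setoid.ker p) (Function.surjInv hp ∘ l') α
      = fpi p π := by
  have hs := Function.surjInv_eq hp
  obtain ⟨T, hT⟩ : ∃ T, T = Tm (Setoid.ker p) (Function.surjInv hp ∘ l) (Setoid.ker p)
    (Function.surjInv hp ∘ l') α := ⟨_, rfl⟩
  apply PM_ext
  · apply Tm_le
    · intro x y h; exact congrArg π h
    · intro x y h; exact h
    · intro u v h
      rcases u with u | u <;> rcases v with v | v <;> show _ = _ <;> simp [hs]
      · exact h1 _ _ h
      · exact h3 _ _ h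
      · exact (h3 _ _ (Setoid.symm' _ h)).symm
      · exact h2 _ _ h
  · rw [← hT]
    have R : ∀ u, T.r u (Sum.inr (Function.surjInv hp (Sum.elim (fun x => π (p x)) p u))) := by
      rintro (u | u)
      · obtain ⟨x, y, hxy, hl⟩ := h4 (p u)
        have a1 : T.r (Sum.inl u) (Sum.inl (Function.surjInv hp (l x))) := by
          rw [hT]; exact Tm_e (by show p _ = p _; rw [hs, hl])
        have a2 : T.r (Sum.inl (Function.surjInv hp (l x)))
            (Sum.inr (Function.surjInv hp (l' y))) := by
          rw [hT]; exact Tm_β hxy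
        have := h3 x y hxy
        simp only [Sum.elim_inl]
        rw [← hl, this]
        exact Setoid.trans' _ a1 a2
      · rw [hT]; exact Tm_e' (by show p _ = p _; rw [hs]; rfl)
    intro u v h
    have h : Sum.elim (fun x => π (p x)) p u = Sum.elim (fun x => π (p x)) p v := h
    have h2 := R v
    rw [← h] at h2
    exact Setoid.trans' _ (R u) (Setoid.symm' _ h2)

lemma expand (hp : Function.Surjective p) (β : PM n) (a b : Fin q → Fin n)
    (π : Equiv.Perm (Fin q)) (e e' : Setoid (Fin n))
    (he : ∀ x y, e.r x y ↔ β.r (Sum.inl x) (Sum.inl y))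
    (he' : ∀ x y, e'.r x y ↔ β.r (Sum.inr x) (Sum.inr y))
    (hab : ∀ s, β.r (Sum.inl (a s)) (Sum.inr (b (π s))))
    (hcov : ∀ u v, β.r (Sum.inl u) (Sum.inr v) → ∃ s, β.r (Sum.inl u) (Sum.inl (a s))) :
    Tm e (a ∘ p) e' (b ∘ p) (fpi p π) = β := by
  apply PM_ext
  · apply Tm_le
    · intro x y h; exact (he _ _).1 h
    · intro x y h; exact (he' _ _).1 h
    · intro u v h
      have R : ∀ u, β.r (Sum.map (a ∘ p) (b ∘ p) u)
          (Sum.inr (b (Sum.elim (fun x => π (p x)) p u))) := by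
        rintro (u | u)
        · exact hab _
        · exact β.refl _
      have h : Sum.elim (fun x => π (p x)) p u = Sum.elim (fun x => π (p x)) p v := h
      have h2 := R v
      rw [← h] at h2
      exact Setoid.trans' _ (R u) (Setoid.symm' _ h2)
  · have key : ∀ u v, β.r (Sum.inl u) (Sum.inr v) →
        (Tm e (a ∘ p) e' (b ∘ p) (fpi p π)).r (Sum.inl u) (Sum.inr v) := by
      intro u v h
      obtain ⟨s, hs⟩ := hcov u v h
      obtain ⟨x, hx⟩ := hp s
      obtain ⟨y, hy⟩ := hp (π s)
      have a1 := Tm_e (e := e) (c := a ∘ p) (e' := e') (c' := b ∘ p) (β := fpi p π)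
        ((he _ _).2 hs)
      have a2 := Tm_β (e := e) (c := a ∘ p) (e' := e') (c' := b ∘ p) (β := fpi p π)
        (u := Sum.inl x) (v := Sum.inr y) (by show π (p x) = p y; rw [hx, hy])
      simp only [Sum.map_inl, Sum.map_inr, Function.comp, hx, hy] at a2
      have a3 := Tm_e' (e := e) (c := a ∘ p) (e' := e') (c' := b ∘ p) (β := fpi p π)
        ((he' _ _).2 (Setoid.trans' _ (Setoid.symm' _ (hab s)) (Setoid.trans' _
          (Setoid.symm' _ hs) h)))
      exact Setoid.trans' _ a1 (Setoid.trans' _ a2 a3)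
    intro u v h
    rcases u with u | u <;> rcases v with v | v
    · exact Tm_e ((he _ _).2 h)
    · exact key _ _ h
    · exact Setoid.symm' _ (key _ _ (Setoid.symm' _ h))
    · exact Tm_e' ((he' _ _).2 h)

lemma rnk_fe (hp : Function.Surjective p) : rnk (fe (Setoid.ker p)) = q := by
  have hs := Function.surjInv_eq hp
  apply le_antisymm
  · refine rnk_le_of_cover (Function.surjInv hp) ?_
    intro u v _
    refine ⟨p u, ?_⟩
    show p u = p (Function.surjInv hp (p u))
    rw [hs]
  · refine rnk_ge_of_inj (Function.surjInv hp) (Function.surjInv hp) ?_ ?_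
    · intro s t h
      have h : p (Function.surjInv hp s) = p (Function.surjInv hp t) := h
      rwa [hs, hs] at h
    · intro s; exact fe_refl _ _

end fact
/-! ### The universal case -/

section universal
variable {σ : (ℕ × PM n) → (ℕ × PM n) → Prop} {q : ℕ}

def Rcomb (α β : PM n) : Prop :=
  (∀ x y, α.r (Sum.inl x) (Sum.inl y) ↔ β.r (Sum.inl x) (Sum.inl y)) ∧
  ∀ x, (∃ y, α.r (Sum.inl x) (Sum.inr y)) ↔ ∃ y, β.r (Sum.inl x) (Sum.inr y)

lemma exists_surj (hq : 2 ≤ q) (hqn : q ≤ n) : ∃ p : Fin n → Fin q, Function.Surjective p := by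
  refine ⟨fun x => ⟨min x (q - 1), by omega⟩, ?_⟩
  intro s
  refine ⟨⟨s, by omega⟩, ?_⟩
  apply Fin.ext
  simp only
  omega

lemma exists_perm {X : Type*} [DecidableEq X] {a b c d : X} (h1 : a ≠ b) (h2 : c ≠ d) :
    ∃ π : Equiv.Perm X, π a = c ∧ π b = d := by
  have h3 : Equiv.swap a c b ≠ c := by
    intro h
    have h' : Equiv.swap a c b = Equiv.swap a c a := by rw [h, Equiv.swap_apply_left]
    exact h1 ((Equiv.swap a c).injective h').symm
  refine ⟨(Equiv.swap (Equiv.swap a c b) d) * Equiv.swap a c, ?_, ?_⟩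
  · rw [Equiv.Perm.mul_apply, Equiv.swap_apply_left, Equiv.swap_apply_of_ne_of_ne h3.symm h2]
  · rw [Equiv.Perm.mul_apply, Equiv.swap_apply_left]

open Classical in
lemma mk_l {α : PM n} {a : Fin q → Fin n}
    (ha : ∀ s t, α.r (Sum.inl (a s)) (Sum.inl (a t)) → s = t) (h : Fin n → Fin q)
    (hh : ∀ x y, α.r (Sum.inl x) (Sum.inl y) → h x = h y) :
    ∃ l : Fin n → Fin q, (∀ x y, α.r (Sum.inl x) (Sum.inl y) → l x = l y) ∧
      (∀ t z, α.r (Sum.inl z) (Sum.inl (a t)) → l z = t) ∧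
      (∀ z, (¬ ∃ t, α.r (Sum.inl z) (Sum.inl (a t))) → l z = h z) := by
  let l : Fin n → Fin q := fun z =>
    if H : ∃ t, α.r (Sum.inl z) (Sum.inl (a t)) then H.choose else h z
  have l1 : ∀ t z, α.r (Sum.inl z) (Sum.inl (a t)) → l z = t := by
    intro t z hz
    have H : ∃ t, α.r (Sum.inl z) (Sum.inl (a t)) := ⟨t, hz⟩
    simp only [l]
    rw [dif_pos H]
    exact ha _ _ (Setoid.trans' _ (Setoid.symm' _ H.choose_spec) hz)
  have l2 : ∀ z, (¬ ∃ t, α.r (Sum.inl z) (Sum.inl (a t))) → l z = h z := by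
    intro z hz
    simp only [l]
    rw [dif_neg hz]
  refine ⟨l, ?_, l1, l2⟩
  intro x y hxy
  by_cases H : ∃ t, α.r (Sum.inl y) (Sum.inl (a t))
  · obtain ⟨t, ht⟩ := H
    rw [l1 t y ht, l1 t x (Setoid.trans' _ hxy ht)]
  · rw [l2 y H, l2 x, hh x y hxy]
    rintro ⟨t, ht⟩
    exact H ⟨t, Setoid.trans' _ (Setoid.symm' _ hxy) ht⟩

open Classical in
lemma mk_l' {α : PM n} (hq : 2 ≤ q) {a : Fin q → Fin n}
    (ha : ∀ s t, α.r (Sum.inl (a s)) (Sum.inl (a t)) → s = t) :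
    ∃ l' : Fin n → Fin q, (∀ x y, α.r (Sum.inr x) (Sum.inr y) → l' x = l' y) ∧
      (∀ t z, α.r (Sum.inl (a t)) (Sum.inr z) → l' z = t) := by
  let l' : Fin n → Fin q := fun z =>
    if H : ∃ t, α.r (Sum.inl (a t)) (Sum.inr z) then H.choose else ⟨0, by omega⟩
  have l1 : ∀ t z, α.r (Sum.inl (a t)) (Sum.inr z) → l' z = t := by
    intro t z hz
    have H : ∃ t, α.r (Sum.inl (a t)) (Sum.inr z) := ⟨t, hz⟩
    simp only [l']
    rw [dif_pos H]
    exact ha _ _ (Setoid.trans' _ H.choose_spec (Setoid.symm' _ hz))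
  refine ⟨l', ?_, l1⟩
  intro x y hxy
  by_cases H : ∃ t, α.r (Sum.inl (a t)) (Sum.inr y)
  · obtain ⟨t, ht⟩ := H
    rw [l1 t y ht, l1 t x (Setoid.trans' _ ht (Setoid.symm' _ hxy))]
  · have H' : ¬ ∃ t, α.r (Sum.inl (a t)) (Sum.inr x) := by
      rintro ⟨t, ht⟩
      exact H ⟨t, Setoid.trans' _ ht hxy⟩
    simp only [l']
    rw [dif_neg H, dif_neg H']

lemma core (hσ : IsCongruence (tmul (n := n)) σ) (hq : 2 ≤ q) {α β : PM n}
    (h : σ (0, α) (0, β)) {a b : Fin q → Fin n}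
    (ha : ∀ s t, α.r (Sum.inl (a s)) (Sum.inl (a t)) → s = t)
    (hab : ∀ s, α.r (Sum.inl (a s)) (Sum.inr (b s)))
    (hcov : ∀ u v, α.r (Sum.inl u) (Sum.inr v) → ∃ s, α.r (Sum.inl u) (Sum.inl (a s)))
    (l : Fin n → Fin q) (l1 : ∀ x y, α.r (Sum.inl x) (Sum.inl y) → l x = l y)
    (l2 : ∀ t z, α.r (Sum.inl z) (Sum.inl (a t)) → l z = t)
    (hβ : (∃ x y, β.r (Sum.inl x) (Sum.inl y) ∧ l x ≠ l y) ∨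
      ∃ t, ∀ u v, β.r u v → (cutAt l t u ↔ cutAt l t v))
    {p : Fin n → Fin q} (hp : Function.Surjective p) :
    σ (0, fe (Setoid.ker p)) (0, fe ⊤) := by
  obtain ⟨l', l1', l2'⟩ := mk_l' hq ha
  have main : ∀ {p : Fin n → Fin q} (hp : Function.Surjective p),
      σ (0, fe (Setoid.ker p)) (0, Tm (Setoid.ker p) (Function.surjInv hp ∘ l) (Setoid.ker p)
        (Function.surjInv hp ∘ l') β) := by
    intro p hp
    have := cong_T hσ (Setoid.ker p) (Function.surjInv hp ∘ l) (Setoid.ker p)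
        (Function.surjInv hp ∘ l') h
    rw [collapse hp l l' 1 α l1 l1' ?_ ?_, fpi_one] at this
    · exact this
    · intro x y hxy
      obtain ⟨s, hs⟩ := hcov x y hxy
      rw [l2 s x hs, l2' s y (Setoid.trans' _ (Setoid.symm' _ hs) hxy)]
      rfl
    · intro t
      exact ⟨a t, b t, hab t, l2 t _ (α.refl _)⟩
  apply all_omega hσ
  intro x y
  by_cases hxy : p x = p y
  · exact ⟨Setoid.ker p, hxy, hσ.1.refl _⟩
  have hker : ∀ π : Equiv.Perm (Fin q), Setoid.ker (π ∘ p) = Setoid.ker p := by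
    intro π
    ext x y
    exact π.injective.eq_iff
  rcases hβ with ⟨x0, y0, hb, hl⟩ | ⟨t, ht⟩
  · obtain ⟨π, hx, hy⟩ := exists_perm hxy hl
    have hp' : Function.Surjective (π ∘ p) := π.surjective.comp hp
    have hs := Function.surjInv_eq hp'
    have hloc : ∀ x y, (Setoid.ker (π ∘ p)).r x y →
        (Tm (Setoid.ker (π ∘ p)) (Function.surjInv hp' ∘ l) (Setoid.ker (π ∘ p))
        (Function.surjInv hp' ∘ l') β).r (Sum.inl x) (Sum.inl y) := fun x y h => Tm_e h
    rw [← hker π]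
    refine stepB_merged hσ _ _ (main hp') hloc ?_
    have h2 := Tm_β (e := Setoid.ker (π ∘ p)) (c := Function.surjInv hp' ∘ l)
      (e' := Setoid.ker (π ∘ p)) (c' := Function.surjInv hp' ∘ l') hb
    have h1 := hloc x (Function.surjInv hp' (l x0)) ((show (π ∘ p) x = l x0 from hx).trans
      (hs _).symm)
    have h3 := hloc y (Function.surjInv hp' (l y0)) ((show (π ∘ p) y = l y0 from hy).trans
      (hs _).symm)
    exact Setoid.trans' _ h1 (Setoid.trans' _ h2 (Setoid.symm' _ h3))
  · have hp' : Function.Surjective (Equiv.swap (p x) t ∘ p) := (Equiv.surjective _).comp hp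
    have hs := Function.surjInv_eq hp'
    rw [← hker (Equiv.swap (p x) t)]
    refine stepB_cut (t := t) hσ (fun x y h => Tm_e h) (main hp') ?_ x y ?_ ?_
    · have : ∀ u v, (Tm (Setoid.ker (Equiv.swap (p x) t ∘ p)) (Function.surjInv hp' ∘ l)
          (Setoid.ker (Equiv.swap (p x) t ∘ p)) (Function.surjInv hp' ∘ l') β).r u v →
          (Setoid.ker (cutAt (Equiv.swap (p x) t ∘ p) t)).r u v := by
        apply Tm_le
        · intro x' y' h
          have h : (Equiv.swap (p x) t ∘ p) x' = (Equiv.swap (p x) t ∘ p) y' := h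
          show (_ = t) = (_ = t)
          rw [h]
        · intro x y h; rfl
        · intro u v h
          have hc := ht u v h
          apply propext
          rcases u with u | u <;> rcases v with v | v <;>
            simp only [cutAt, Sum.map_inl, Sum.map_inr, Sum.elim_inl, Sum.elim_inr] at hc ⊢
          · simp only [Function.comp_apply (f := Function.surjInv hp'), hs]
            exact hc
          · simp only [Function.comp_apply (f := Function.surjInv hp'), hs]
            exact hc
          · simp only [Function.comp_apply (f := Function.surjInv hp'), hs]
            exact hc
      exact fun u v h => iff_of_eq (this u v h)
    · simp
    · simp only [Function.comp]
      intro h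
      apply hxy
      apply (Equiv.swap (p x) t).injective
      rw [h, Equiv.swap_apply_left]

lemma univ_of (hσ : IsCongruence (tmul (n := n)) σ) (hq : 2 ≤ q)
    {p : Fin n → Fin q} (hp : Function.Surjective p)
    (h : σ (0, fe (Setoid.ker p)) (0, fe ⊤)) (k : ℕ) (x : PM n) (hx : rnk x ≤ q) :
    σ (k, x) (0, Dm) := by
  obtain ⟨A, hA⟩ : ∃ A : Fin n → Prop, A = fun x => p x = ⟨0, by omega⟩ := ⟨_, rfl⟩
  obtain ⟨x0, h0⟩ := hp ⟨0, by omega⟩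
  obtain ⟨x1, h1⟩ := hp ⟨1, by omega⟩
  have h0 : A x0 := by rw [hA]; exact h0
  have h1 : ¬ A x1 := by
    rw [hA]; simp only [h1]
    intro h
    simp at h
  have hle : Setoid.ker p ≤ Setoid.ker A := by
    intro x y h
    have h : p x = p y := h
    show A x = A y
    rw [hA]
    simp only [h]
  have hA' : σ (0, fe (Setoid.ker A)) (0, fe ⊤) := by
    have := cong_l hσ (fe (Setoid.ker A)) h
    rw [Phi_fe, Phi_fe, fe_sup, fe_sup, sup_eq_left.2 hle, sup_top_eq] at this
    exact this
  by_cases hr : rnk x = 0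
  · exact NT_Dm hσ h0 h1 hA' k x (NT_of_rnk hr)
  obtain ⟨a, b, hab, hcov⟩ := rep_le hx hr
  have s1 : σ (k, fe (Setoid.ker p)) (0, Dm) := by
    have := cong_lvl hσ k h
    simp only [zero_add] at this
    exact hσ.1.trans this (omega_Dm hσ h0 h1 hA' k)
  have s2 := cong_T hσ (Setoid.comap Sum.inl x) (a ∘ p) (Setoid.comap Sum.inr x) (b ∘ p) s1
  rw [← fpi_one, expand hp x a b 1 _ _ (fun _ _ => Iff.rfl) (fun _ _ => Iff.rfl) hab hcov] at s2
  refine hσ.1.trans s2 (NT_Dm hσ h0 h1 hA' 0 _ ?_)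
  intro u v huv
  have : ∀ u v, (Tm (Setoid.comap Sum.inl x) (a ∘ p) (Setoid.comap Sum.inr x) (b ∘ p) Dm).r u v →
      (Setoid.ker Sum.isLeft).r u v := by
    apply Tm_le
    · intro x y _; rfl
    · intro x y _; rfl
    · intro u w h
      rcases u with u | u <;> rcases w with w | w
      · rfl
      · have h : True = False := h
        simp at h
      · have h : False = True := h
        simp at h
      · rfl
  cases (show true = false from this _ _ huv)

open Classical in
lemma caseK (hσ : IsCongruence (tmul (n := n)) σ) (hq : 2 ≤ q) {α β : PM n}
    (h : σ (0, α) (0, β)) (hα : rnk α = q) {x y : Fin n} (hβ : β.r (Sum.inl x) (Sum.inl y))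
    (hxy : ¬ α.r (Sum.inl x) (Sum.inl y)) {p : Fin n → Fin q} (hp : Function.Surjective p) :
    σ (0, fe (Setoid.ker p)) (0, fe ⊤) := by
  obtain ⟨a, b, ha, hab, hcov⟩ := rep hα
  have fin : (∃ hh : Fin n → Fin q, (∀ x y, α.r (Sum.inl x) (Sum.inl y) → hh x = hh y) ∧
      ∀ l : Fin n → Fin q, (∀ t z, α.r (Sum.inl z) (Sum.inl (a t)) → l z = t) →
      (∀ z, (¬ ∃ t, α.r (Sum.inl z) (Sum.inl (a t))) → l z = hh z) → l x ≠ l y) →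
      σ (0, fe (Setoid.ker p)) (0, fe ⊤) := by
    rintro ⟨hh, h1, h2⟩
    obtain ⟨l, l1, l2, l3⟩ := mk_l ha hh h1
    exact core hσ hq h ha hab hcov l l1 l2 (Or.inl ⟨x, y, hβ, h2 l l2 l3⟩) hp
  have : Nontrivial (Fin q) := Fin.nontrivial_iff_two_le.2 hq
  apply fin
  by_cases hx : ∃ s, α.r (Sum.inl x) (Sum.inl (a s)) <;>
    by_cases hy : ∃ s, α.r (Sum.inl y) (Sum.inl (a s))
  · obtain ⟨s, hs⟩ := hx
    obtain ⟨t, ht⟩ := hy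
    refine ⟨fun _ => s, fun _ _ _ => rfl, fun l l2 l3 => ?_⟩
    rw [l2 s x hs, l2 t y ht]
    rintro rfl
    exact hxy (Setoid.trans' _ hs (Setoid.symm' _ ht))
  · obtain ⟨s, hs⟩ := hx
    obtain ⟨v, hv⟩ := exists_ne s
    refine ⟨fun _ => v, fun _ _ _ => rfl, fun l l2 l3 => ?_⟩
    rw [l2 s x hs, l3 y hy]
    exact hv.symm
  · obtain ⟨s, hs⟩ := hy
    obtain ⟨v, hv⟩ := exists_ne s
    refine ⟨fun _ => v, fun _ _ _ => rfl, fun l l2 l3 => ?_⟩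
    rw [l2 s y hs, l3 x hx]
    exact hv
  · obtain ⟨s, t, hst⟩ := exists_pair_ne (Fin q)
    refine ⟨fun z => if α.r (Sum.inl z) (Sum.inl x) then s else t, ?_, fun l l2 l3 => ?_⟩
    · intro z w hzw
      have : α.r (Sum.inl z) (Sum.inl x) ↔ α.r (Sum.inl w) (Sum.inl x) :=
        ⟨fun h => Setoid.trans' _ (Setoid.symm' _ hzw) h, fun h => Setoid.trans' _ hzw h⟩
      simp only [this]
    · rw [l3 x hx, l3 y hy]
      simp only
      rw [if_pos (α.refl _), if_neg (fun h => hxy (Setoid.symm' _ h))]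
      exact hst

lemma caseT (hσ : IsCongruence (tmul (n := n)) σ) (hq : 2 ≤ q) {α β : PM n}
    (h : σ (0, α) (0, β)) (hα : rnk α = q)
    (hk : ∀ x y, α.r (Sum.inl x) (Sum.inl y) ↔ β.r (Sum.inl x) (Sum.inl y))
    {x : Fin n} (hxα : ∃ y, α.r (Sum.inl x) (Sum.inr y))
    (hxβ : ¬ ∃ y, β.r (Sum.inl x) (Sum.inr y)) {p : Fin n → Fin q}
    (hp : Function.Surjective p) :
    σ (0, fe (Setoid.ker p)) (0, fe ⊤) := by
  obtain ⟨a, b, ha, hab, hcov⟩ := rep hα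
  have : Nontrivial (Fin q) := Fin.nontrivial_iff_two_le.2 hq
  obtain ⟨y, hy⟩ := hxα
  obtain ⟨t, ht⟩ := hcov x y hy
  obtain ⟨v, hv⟩ := exists_ne t
  obtain ⟨l, l1, l2, l3⟩ := mk_l ha (fun _ => v) (fun _ _ _ => rfl)
  refine core hσ hq h ha hab hcov l l1 l2 (Or.inr ⟨t, ?_⟩) hp
  have key : ∀ u w, β.r (Sum.inl u) (Sum.inr w) → l u ≠ t := by
    intro u w huw hl
    by_cases H : ∃ s, α.r (Sum.inl u) (Sum.inl (a s))
    · obtain ⟨s, hs⟩ := H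
      rw [l2 s u hs] at hl
      subst hl
      exact hxβ ⟨w, Setoid.trans' _ ((hk _ _).1 (Setoid.trans' _ ht (Setoid.symm' _ hs))) huw⟩
    · rw [l3 u H] at hl
      exact hv hl
  intro u w huw
  rcases u with u | u <;> rcases w with w | w <;>
    simp only [cutAt, Sum.elim_inl, Sum.elim_inr, iff_false, false_iff]
  · rw [l1 _ _ ((hk _ _).2 huw)]
  · exact key _ _ huw
  · exact key _ _ (Setoid.symm' _ huw)

lemma ABC (hσ : IsCongruence (tmul (n := n)) σ) (hq : 2 ≤ q) (hqn : q ≤ n) {α β : PM n}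
    (h : σ (0, α) (0, β)) (hα : rnk α = q) (hβ : rnk β = q) (hR : ¬ Rcomb α β)
    (k m : ℕ) (x y : PM n) (hx : rnk x ≤ q) (hy : rnk y ≤ q) : σ (k, x) (m, y) := by
  obtain ⟨p, hp⟩ := exists_surj hq hqn
  have key : σ (0, fe (Setoid.ker p)) (0, fe ⊤) := by
    by_cases hk : ∀ x y, α.r (Sum.inl x) (Sum.inl y) ↔ β.r (Sum.inl x) (Sum.inl y)
    · by_cases hd : ∀ x, (∃ y, α.r (Sum.inl x) (Sum.inr y)) ↔ ∃ y, β.r (Sum.inl x) (Sum.inr y)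
      · exact absurd ⟨hk, hd⟩ hR
      · obtain ⟨z, hz⟩ := not_forall.1 hd
        by_cases h1 : ∃ y, α.r (Sum.inl z) (Sum.inr y)
        · have h2 : ¬ ∃ y, β.r (Sum.inl z) (Sum.inr y) := fun h2 => hz ⟨fun _ => h2, fun _ => h1⟩
          exact caseT hσ hq h hα hk h1 h2 hp
        · have h2 : ∃ y, β.r (Sum.inl z) (Sum.inr y) := by
            by_contra h2
            exact hz ⟨fun h => absurd h h1, fun h => absurd h h2⟩
          exact caseT hσ hq (hσ.1.symm h) hβ (fun x y => (hk x y).symm) h2 h1 hp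
    · obtain ⟨z, hz⟩ := not_forall.1 hk
      obtain ⟨w, hz⟩ := not_forall.1 hz
      by_cases h1 : α.r (Sum.inl z) (Sum.inl w)
      · have h2 : ¬ β.r (Sum.inl z) (Sum.inl w) := fun h2 => hz ⟨fun _ => h2, fun _ => h1⟩
        exact caseK hσ hq (hσ.1.symm h) hβ h1 h2 hp
      · have h2 : β.r (Sum.inl z) (Sum.inl w) := by
          by_contra h2
          exact hz ⟨fun h => absurd h h1, fun h => absurd h h2⟩
        exact caseK hσ hq h hα h2 h1 hp
  exact hσ.1.trans (univ_of hσ hq hp key k x hx) (hσ.1.symm (univ_of hσ hq hp key m y hy))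

end universal
/-! ### Green's relations -/

section green

lemma mul_bot (β : PM n) : pmul β (fe ⊥) = β := mul_fe (by
  intro x y h
  cases (show x = y from h)
  exact β.refl _)

open Classical in
lemma RF {β x : PM n} (h1 : ∀ z w, β.r (Sum.inl z) (Sum.inl w) → x.r (Sum.inl z) (Sum.inl w))
    (h2 : ∀ z, (¬ ∃ m, β.r (Sum.inl z) (Sum.inr m)) → ∀ v, x.r (Sum.inl z) v →
      ∃ w, v = Sum.inl w ∧ β.r (Sum.inl z) (Sum.inl w)) :
    pmul β (pmul (star β) x) = x := by
  let G : Fin n → Option (Quotient x) := fun m =>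
    if H : ∃ z, β.r (Sum.inl z) (Sum.inr m) then some (Quotient.mk x (Sum.inl H.choose)) else none
  have G1 : ∀ z m, β.r (Sum.inl z) (Sum.inr m) → G m = some (Quotient.mk x (Sum.inl z)) := by
    intro z m h
    have H : ∃ z, β.r (Sum.inl z) (Sum.inr m) := ⟨z, h⟩
    simp only [G]
    rw [dif_pos H]
    congr 1
    exact Quotient.sound (h1 _ _ (Setoid.trans' _ H.choose_spec (Setoid.symm' _ h)))
  have G2 : ∀ m m', β.r (Sum.inr m) (Sum.inr m') → G m = G m' := by
    intro m m' h
    by_cases H : ∃ z, β.r (Sum.inl z) (Sum.inr m)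
    · obtain ⟨z, hz⟩ := H
      rw [G1 z m hz, G1 z m' (Setoid.trans' _ hz h)]
    · have H' : ¬ ∃ z, β.r (Sum.inl z) (Sum.inr m') := by
        rintro ⟨z, hz⟩
        exact H ⟨z, Setoid.trans' _ hz (Setoid.symm' _ h)⟩
      simp only [G]
      rw [dif_neg H, dif_neg H']
  let F : W n → Option (Quotient x) := Sum.elim (fun z => some (Quotient.mk x (Sum.inl z)))
    (Sum.elim G (fun y => some (Quotient.mk x (Sum.inr y))))
  let F' : W n → Option (Quotient x) := Sum.elim G
    (Sum.elim (fun z => some (Quotient.mk x (Sum.inl z)))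
      (fun y => some (Quotient.mk x (Sum.inr y))))
  have q1 : ∀ z w, β.r (Sum.inl z) (Sum.inl w) →
      Quotient.mk x (Sum.inl z) = Quotient.mk x (Sum.inl w) := fun z w h =>
    Quotient.sound (h1 _ _ h)
  have hF' : ∀ a c, conn (star β) x a c → F' a = F' c := by
    intro a c h
    refine conn_le F' ?_ ?_ h
    · intro u v h
      rcases u with u | u <;> rcases v with v | v
      · exact G2 _ _ h
      · exact G1 _ _ (Setoid.symm' _ h)
      · exact (G1 _ _ h).symm
      · exact congrArg some (q1 _ _ h)
    · intro u v h
      have := congrArg some (Quotient.sound h : Quotient.mk x u = Quotient.mk x v)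
      rcases u with u | u <;> rcases v with v | v <;> exact this
  have hF : ∀ a c, conn β (pmul (star β) x) a c → F a = F c := by
    intro a c h
    refine conn_le F ?_ ?_ h
    · intro u v h
      rcases u with u | u <;> rcases v with v | v
      · exact congrArg some (q1 _ _ h)
      · exact (G1 _ _ h).symm
      · exact G1 _ _ (Setoid.symm' _ h)
      · exact G2 _ _ h
    · intro u v h
      have := hF' _ _ h
      rcases u with u | u <;> rcases v with v | v <;> exact this
  apply PM_ext
  · intro u v h
    have := hF _ _ h
    rcases u with u | u <;> rcases v with v | v <;>
      exact Quotient.exact (Option.some_injective _ this)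
  · have good : ∀ u : V n, (∀ z, u = Sum.inl z → ∃ m, β.r (Sum.inl z) (Sum.inr m)) →
        ∃ u' : V n, conn β (pmul (star β) x) (topBot u) (midBot u') ∧
          conn (star β) x (topBot u') (midBot u) := by
      rintro (u | u) h
      · obtain ⟨m, hm⟩ := h u rfl
        exact ⟨Sum.inl m, conn_l (u := Sum.inl u) (v := Sum.inr m) hm,
          conn_l (u := Sum.inl m) (v := Sum.inr u) (Setoid.symm' β hm)⟩
      · exact ⟨Sum.inr u, conn_refl _, conn_refl _⟩
    have bad : ∀ u v : V n, (¬ ∀ z, u = Sum.inl z → ∃ m, β.r (Sum.inl z) (Sum.inr m)) →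
        x.r u v → (pmul β (pmul (star β) x)).r u v := by
      intro u v h hx
      push Not at h
      obtain ⟨z, rfl, hz⟩ := h
      obtain ⟨w, rfl, hw⟩ := h2 z (by rintro ⟨m, hm⟩; exact hz m hm) v hx
      exact conn_l (u := Sum.inl z) (v := Sum.inl w) hw
    intro u v h
    by_cases hu : ∀ z, u = Sum.inl z → ∃ m, β.r (Sum.inl z) (Sum.inr m)
    · by_cases hv : ∀ z, v = Sum.inl z → ∃ m, β.r (Sum.inl z) (Sum.inr m)
      · obtain ⟨u', a1, a2⟩ := good u hu
        obtain ⟨v', b1, b2⟩ := good v hv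
        have : (pmul (star β) x).r u' v' := conn_trans a2 (conn_trans (conn_r h) (conn_symm b2))
        exact conn_trans a1 (conn_trans (conn_r this) (conn_symm b1))
      · exact Setoid.symm' _ (bad v u hv (Setoid.symm' _ h))
    · exact bad u v hu h

lemma Rcomb_symm {α β : PM n} (h : Rcomb α β) : Rcomb β α :=
  ⟨fun x y => (h.1 x y).symm, fun x => (h.2 x).symm⟩

lemma range_sub {α β : PM n} (h : Rcomb α β) : Set.range (pmul α) ⊆ Set.range (pmul β) := by
  rintro _ ⟨γ, rfl⟩
  refine ⟨_, RF (β := β) (x := pmul α γ) ?_ ?_⟩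
  · intro z w hzw
    exact conn_l (u := Sum.inl z) (v := Sum.inl w) ((h.1 _ _).2 hzw)
  · intro z hz v hv
    have hz' : ∀ w m, α.r (Sum.inl z) (Sum.inl w) → ¬ α.r (Sum.inl w) (Sum.inr m) := by
      intro w m h1 h2
      exact hz ((h.2 z).1 ⟨m, Setoid.trans' _ h1 h2⟩)
    let F : W n → Prop := Sum.elim (fun w => α.r (Sum.inl z) (Sum.inl w)) (fun _ => False)
    have := conn_le (α := α) (β := γ) F ?_ ?_ hv
    · have h3 : F (topBot v) := by
        rw [← this]
        exact α.refl _
      rcases v with v | v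
      · exact ⟨v, rfl, (h.1 _ _).1 h3⟩
      · exact h3.elim
    · intro u v huv
      rcases u with u | u <;> rcases v with v | v
      · exact propext ⟨fun h => Setoid.trans' _ h huv,
          fun h => Setoid.trans' _ h (Setoid.symm' _ huv)⟩
      · exact eq_false fun h => hz' _ _ h huv
      · exact (eq_false fun h => hz' _ _ h (Setoid.symm' _ huv)).symm
      · rfl
    · intro u v huv
      rcases u with u | u <;> rcases v with v | v <;> rfl

lemma greenR_iff (α β : PM n) : greenR pmul α β ↔ Rcomb α β := by
  constructor
  · intro h
    have h : Set.range (pmul α) = Set.range (pmul β) := h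
    have key : ∀ {α β : PM n}, Set.range (pmul α) = Set.range (pmul β) → ∃ γ, α = pmul β γ := by
      intro α β h
      have : α ∈ Set.range (pmul β) := by rw [← h]; exact ⟨_, mul_bot α⟩
      obtain ⟨γ, hγ⟩ := this
      exact ⟨γ, hγ.symm⟩
    have k1 : ∀ {α β : PM n}, (∃ γ, α = pmul β γ) →
        ∀ x y, β.r (Sum.inl x) (Sum.inl y) → α.r (Sum.inl x) (Sum.inl y) := by
      rintro α β ⟨γ, rfl⟩ x y h
      exact conn_l (u := Sum.inl x) (v := Sum.inl y) h
    have hk : ∀ x y, α.r (Sum.inl x) (Sum.inl y) ↔ β.r (Sum.inl x) (Sum.inl y) :=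
      fun x y => ⟨k1 (key h.symm) x y, k1 (key h) x y⟩
    have k2 : ∀ {α β : PM n}, (∃ γ, α = pmul β γ) →
        (∀ x y, α.r (Sum.inl x) (Sum.inl y) → β.r (Sum.inl x) (Sum.inl y)) →
        ∀ x, (∃ y, α.r (Sum.inl x) (Sum.inr y)) → (∃ y, β.r (Sum.inl x) (Sum.inr y)) := by
      rintro α β ⟨γ, rfl⟩ hk x ⟨y, hy⟩
      obtain ⟨z, w, a, b⟩ := trans_of_mul hy
      exact ⟨w, Setoid.trans' _ (hk _ _ b) a⟩
    exact ⟨hk, fun x => ⟨k2 (key h) (fun x y => (hk x y).1) x,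
      k2 (key h.symm) (fun x y => (hk x y).2) x⟩⟩
  · intro h
    exact Set.Subset.antisymm (range_sub h) (range_sub (Rcomb_symm h))

lemma range_star (α : PM n) :
    Set.range (fun a => pmul a α) = star '' Set.range (pmul (star α)) := by
  ext x
  constructor
  · rintro ⟨a, rfl⟩
    exact ⟨_, ⟨star a, rfl⟩, by rw [pmul_star, star_star]⟩
  · rintro ⟨_, ⟨a, rfl⟩, rfl⟩
    refine ⟨star a, ?_⟩
    show pmul (star a) α = _
    rw [← pmul_star, star_star]

lemma greenL_iff (α β : PM n) : greenL pmul α β ↔ Rcomb (star α) (star β) := by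
  rw [← greenR_iff]
  unfold greenL greenR
  rw [range_star, range_star]
  have : Function.Injective (star : PM n → PM n) := fun a b h => by
    rw [← star_star a, h, star_star]
  exact this.image_injective.eq_iff

lemma greenH_iff (α β : PM n) :
    greenH pmul α β ↔ Rcomb α β ∧ Rcomb (star α) (star β) := by
  unfold greenH
  rw [greenR_iff, greenL_iff]

end green

/-! ### The main theorem -/

section final
variable {σ : (ℕ × PM n) → (ℕ × PM n) → Prop} {q : ℕ}

lemma ABC' (hσ : IsCongruence (tmul (n := n)) σ) (hq : 2 ≤ q) (hqn : q ≤ n) {i : ℕ} {α β : PM n}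
    (h : σ (i, α) (i, β)) (hα : rnk α = q) (hβ : rnk β = q)
    (hR : ¬ (Rcomb α β ∧ Rcomb (star α) (star β)))
    (k m : ℕ) (x y : PM n) (hx : rnk x ≤ q) (hy : rnk y ≤ q) : σ (i + k, x) (i + m, y) := by
  by_cases h1 : Rcomb α β
  · have h2 : ¬ Rcomb (star α) (star β) := fun h2 => hR ⟨h1, h2⟩
    have := ABC (star_cong (shift_cong hσ i)) hq hqn (α := star α) (β := star β) (by
      show σ (i + 0, star (star α)) (i + 0, star (star β))
      rw [star_star, star_star]; exact h) (by rw [rnk_star, hα]) (by rw [rnk_star, hβ]) h2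
      k m (star x) (star y) (by rwa [rnk_star]) (by rwa [rnk_star])
    have this : σ (i + k, star (star x)) (i + m, star (star y)) := this
    rwa [star_star, star_star] at this
  · exact ABC (shift_cong hσ i) hq hqn (α := α) (β := β) h hα hβ h1 k m x y hx hy

/-- The normal subgroup attached to a row. -/
def Ngrp (hσ : IsCongruence (tmul (n := n)) σ) {p : Fin n → Fin q} (hp : Function.Surjective p)
    (i : ℕ) : Subgroup (Equiv.Perm (Fin q)) where
  carrier := {π | σ (i, fpi p 1) (i, fpi p π)}
  one_mem' := hσ.1.refl _
  mul_mem' := by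
    intro π ρ hπ hρ
    have hπ : σ (i, fpi p 1) (i, fpi p π) := hπ
    have hρ : σ (i, fpi p 1) (i, fpi p ρ) := hρ
    have := cong_l hσ (fpi p ρ) hπ
    rw [(fpi_mul hp _ _).1, (fpi_mul hp _ _).1, (fpi_mul hp _ _).2, (fpi_mul hp _ _).2,
      one_mul] at this
    exact hσ.1.trans hρ this
  inv_mem' := by
    intro π hπ
    have hπ : σ (i, fpi p 1) (i, fpi p π) := hπ
    have := cong_l hσ (fpi p π⁻¹) hπ
    rw [(fpi_mul hp _ _).1, (fpi_mul hp _ _).1, (fpi_mul hp _ _).2, (fpi_mul hp _ _).2,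
      one_mul, mul_inv_cancel] at this
    exact hσ.1.symm this

lemma Ngrp_mem (hσ : IsCongruence (tmul (n := n)) σ) {p : Fin n → Fin q}
    (hp : Function.Surjective p) (i : ℕ) (π : Equiv.Perm (Fin q)) :
    π ∈ Ngrp hσ hp i ↔ σ (i, fpi p 1) (i, fpi p π) := Iff.rfl

lemma Ngrp_normal (hσ : IsCongruence (tmul (n := n)) σ) {p : Fin n → Fin q}
    (hp : Function.Surjective p) (i : ℕ) : (Ngrp hσ hp i).Normal := by
  constructor
  intro π hπ g
  rw [Ngrp_mem] at hπ ⊢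
  have h1 := cong_l hσ (fpi p g⁻¹) hπ
  rw [(fpi_mul hp _ _).1, (fpi_mul hp _ _).1, (fpi_mul hp _ _).2, (fpi_mul hp _ _).2] at h1
  have h2 := cong_r hσ (fpi p g) h1
  rw [(fpi_mul hp _ _).1, (fpi_mul hp _ _).1, (fpi_mul hp _ _).2, (fpi_mul hp _ _).2,
    one_mul, mul_inv_cancel, ← mul_assoc] at h2
  exact h2

lemma nu_sub (hσ : IsCongruence (tmul (n := n)) σ) (hq : 2 ≤ q) {p : Fin n → Fin q}
    (hp : Function.Surjective p) (i : ℕ) {α β : PM n} (hα : rnk α = q)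
    (h : σ (i, α) (i, β)) (hR : Rcomb α β) (hL : Rcomb (star α) (star β)) :
    pdIn q (· ∈ Ngrp hσ hp i) α β := by
  obtain ⟨a, b, ha, hab, hcov⟩ := rep hα
  have hlk : ∀ x y, α.r (Sum.inr x) (Sum.inr y) ↔ β.r (Sum.inr x) (Sum.inr y) := hL.1
  have key : ∀ s, ∃ t, β.r (Sum.inl (a s)) (Sum.inr (b t)) := by
    intro s
    obtain ⟨y, hy⟩ := (hR.2 (a s)).1 ⟨b s, hab s⟩
    obtain ⟨z, hz⟩ := (hL.2 y).2 ⟨a s, Setoid.symm' β hy⟩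
    have hz : α.r (Sum.inr y) (Sum.inl z) := hz
    obtain ⟨t, ht⟩ := hcov z y (Setoid.symm' _ hz)
    refine ⟨t, Setoid.trans' _ hy ((hlk _ _).1 ?_)⟩
    exact Setoid.trans' _ hz (Setoid.trans' _ ht (hab t))
  choose f hf using key
  have hinj : Function.Injective f := by
    intro s s' hs
    apply ha
    rw [hR.1]
    have h1 := hf s
    rw [hs] at h1
    exact Setoid.trans' _ h1 (Setoid.symm' _ (hf s'))
  let π : Equiv.Perm (Fin q) := Equiv.ofBijective f (Finite.injective_iff_bijective.1 hinj)
  have hπ : ∀ s, π s = f s := fun _ => rfl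
  refine ⟨a, b, π, ha, hab, hf, ?_⟩
  show σ (i, fpi p 1) (i, fpi p π)
  obtain ⟨l, l1, l2, -⟩ := mk_l ha (fun _ => ⟨0, by omega⟩) (fun _ _ _ => rfl)
  obtain ⟨l', l1', l2'⟩ := mk_l' hq ha
  have := cong_T hσ (Setoid.ker p) (Function.surjInv hp ∘ l) (Setoid.ker p)
        (Function.surjInv hp ∘ l') h
  rw [collapse hp l l' 1 α l1 l1' ?_ ?_, collapse hp l l' π β ?_ ?_ ?_ ?_] at this
  · exact this
  · intro x y h; exact l1 _ _ ((hR.1 _ _).2 h)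
  · intro x y h; exact l1' _ _ ((hlk _ _).2 h)
  · intro x y hxy
    obtain ⟨y', hy'⟩ := (hR.2 x).2 ⟨y, hxy⟩
    obtain ⟨s, hs⟩ := hcov x y' hy'
    rw [l2 s x hs, hπ]
    symm
    apply l2'
    refine Setoid.trans' _ (hab _) ((hlk _ _).2 ?_)
    exact Setoid.trans' _ (Setoid.symm' _ (hf s))
      (Setoid.trans' _ (Setoid.symm' _ ((hR.1 _ _).1 hs)) hxy)
  · intro t
    exact ⟨a t, b (f t), hf t, l2 t _ (α.refl _)⟩
  · intro x y hxy
    obtain ⟨s, hs⟩ := hcov x y hxy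
    rw [l2 s x hs, l2' s y (Setoid.trans' _ (Setoid.symm' _ hs) hxy)]
    rfl
  · intro t
    exact ⟨a t, b t, hab t, l2 t _ (α.refl _)⟩

lemma nu_sup (hσ : IsCongruence (tmul (n := n)) σ) {p : Fin n → Fin q}
    (hp : Function.Surjective p) (i : ℕ) {α β : PM n} (hα : rnk α = q) (hβ : rnk β = q)
    (hR : Rcomb α β) (hL : Rcomb (star α) (star β))
    (h : pdIn q (· ∈ Ngrp hσ hp i) α β) : σ (i, α) (i, β) := by
  obtain ⟨a, b, π, ha, hab, hb, hN⟩ := h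
  have hN : σ (i, fpi p 1) (i, fpi p π) := hN
  have hlk : ∀ x y, α.r (Sum.inr x) (Sum.inr y) ↔ β.r (Sum.inr x) (Sum.inr y) := hL.1
  have := cong_T hσ (Setoid.comap Sum.inl α) (a ∘ p) (Setoid.comap Sum.inr α) (b ∘ p) hN
  rw [expand hp α a b 1 _ _ (fun _ _ => Iff.rfl) (fun _ _ => Iff.rfl) hab
      (cover_of_rnk hα.le a b ha hab),
    expand hp β a b π _ _ hR.1 hlk hb
      (cover_of_rnk hβ.le a (b ∘ π) (fun s t h => ha s t ((hR.1 _ _).2 h)) hb)] at this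
  exact this

end final

/-- For a congruence `σ` on `P_n^Φ` (`n ≥ 2`), `2 ≤ q ≤ n` and
`i ∈ ℕ`, the restriction `σ_{qi}` is either `D_q × D_q` or `ν_N` for some normal
subgroup `N ⊴ S_q` (the trivial subgroup giving equality on `D_q`); and if it is
`D_q × D_q` with `q ≠ n`, then `D_{qi} ⊆ I(σ)`. -/
theorem rowq_restrictions (n : ℕ) (hn : 2 ≤ n)
    (σ : (ℕ × PM n) → (ℕ × PM n) → Prop) (hσ : IsCongruence (tmul (n := n)) σ)
    (q i : ℕ) (hq2 : 2 ≤ q) (hqn : q ≤ n)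
    (s : PM n → PM n → Prop)
    (hs : s = fun α β => rnk α = q ∧ rnk β = q ∧ σ (i, α) (i, β)) :
    ((s = fun α β => rnk α = q ∧ rnk β = q) ∨
      (∃ N : Subgroup (Equiv.Perm (Fin q)), N.Normal ∧ s = fun α β => nuRel q N α β)) ∧
    ((s = fun α β => rnk α = q ∧ rnk β = q) → q ≠ n →
      ∀ α : PM n, rnk α = q → (i, α) ∈ Isig n σ) := by
  have hs' : ∀ α β, s α β ↔ rnk α = q ∧ rnk β = q ∧ σ (i, α) (i, β) := by
    intro α β
    rw [hs]
  obtain ⟨p, hp⟩ := exists_surj hq2 hqn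
  constructor
  · by_cases H : ∀ α β, s α β → Rcomb α β ∧ Rcomb (star α) (star β)
    · right
      refine ⟨Ngrp hσ hp i, Ngrp_normal hσ hp i, ?_⟩
      funext α β
      apply propext
      unfold nuRel
      rw [hs', greenH_iff]
      constructor
      · rintro ⟨h1, h2, h3⟩
        obtain ⟨hR, hL⟩ := H α β ((hs' _ _).2 ⟨h1, h2, h3⟩)
        exact ⟨h1, h2, ⟨hR, hL⟩, nu_sub hσ hq2 hp i h1 h3 hR hL⟩
      · rintro ⟨h1, h2, ⟨hR, hL⟩, h3⟩
        exact ⟨h1, h2, nu_sup hσ hp i h1 h2 hR hL h3⟩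
    · left
      push Not at H
      obtain ⟨α, β, hαβ, hR⟩ := H
      obtain ⟨h1, h2, h3⟩ := (hs' _ _).1 hαβ
      funext x y
      apply propext
      rw [hs']
      refine ⟨fun h => ⟨h.1, h.2.1⟩, fun h => ⟨h.1, h.2, ?_⟩⟩
      exact ABC' hσ hq2 hqn h3 h1 h2 (fun hc => hR hc.1 hc.2) 0 0 x y h.1.le h.2.le
  · intro hfull hne α hα
    have hlt : q < n := lt_of_le_of_ne hqn hne
    obtain ⟨x, y, hxy, hpxy⟩ := Fintype.exists_ne_map_eq_of_card_lt p (by simpa using hlt)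
    have : Nontrivial (Fin q) := Fin.nontrivial_iff_two_le.2 hq2
    obtain ⟨t, ht⟩ := exists_ne (p x)
    have hp' : Function.Surjective (Function.update p x t) := by
      intro c
      obtain ⟨w, hw⟩ := hp c
      by_cases hwx : w = x
      · refine ⟨y, ?_⟩
        rw [Function.update_of_ne hxy.symm, ← hpxy, ← hwx, hw]
      · exact ⟨w, by rw [Function.update_of_ne hwx, hw]⟩
    have h1 : s (fe (Setoid.ker p)) (fe (Setoid.ker (Function.update p x t))) := by
      rw [hfull]
      exact ⟨rnk_fe hp, rnk_fe hp'⟩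
    obtain ⟨r1, r2, h2⟩ := (hs' _ _).1 h1
    have hU := ABC' hσ hq2 hqn h2 r1 r2 (by
      rintro ⟨hR, -⟩
      have h3 : Function.update p x t x = Function.update p x t y := (hR.1 x y).1 hpxy
      rw [Function.update_self, Function.update_of_ne hxy.symm, ← hpxy] at h3
      exact ht h3)
    refine ⟨_, ⟨ideal_rnk i q, ?_⟩, (⟨le_rfl, hα.le⟩ : i ≤ i ∧ rnk α ≤ q)⟩
    rintro ⟨k, x⟩ ⟨m, y⟩ (h | ⟨⟨a1, a2⟩, ⟨b1, b2⟩⟩)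
    · rw [h]
      exact hσ.1.refl _
    · have a1 : i ≤ k := a1
      have b1 : i ≤ m := b1
      have := hU (k - i) (m - i) x y a2 b2
      rwa [Nat.add_sub_cancel' a1, Nat.add_sub_cancel' b1] at this

end TPM
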